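/- arXiv:2303.05507 — 2 statements merged into one kernel-verified Lean document; each statement's English description precedes it below -/
import Mathlib

section
/- Let n ≥ 1. If φ is a partial proper edge coloring of three edges of C_{2n+1} □ K_2 using colors {1,2,3}, then φ can be extended to a proper 4-edge coloring of C_{2n+1} □ K_2. -/
open SimpleGraph

variable {V : Type*}

/-- Two edges of `G` are adjacent if both are edges, they are distinct,
and they share a vertex. -/
def EdgeAdj (G : SimpleGraph V) (e f : Sym2 V) : Prop :=
  e ∈ G.edgeSet ∧ f ∈ G.edgeSet ∧ e ≠ f ∧ ∃ v, v ∈ e ∧ v ∈ f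

/-- A proper edge coloring (with natural-number colors). -/
def IsProperEdgeColoring (G : SimpleGraph V) (C : Sym2 V → ℕ) : Prop :=
  ∀ ⦃e f⦄, EdgeAdj G e f → C e ≠ C f

/-- A partial proper edge coloring: colored edges are edges of `G`, and
adjacent colored edges receive distinct colors. -/
def IsPartialProperEdgeColoring (G : SimpleGraph V) (φ : Sym2 V → Option ℕ) : Prop :=
  (∀ e, φ e ≠ none → e ∈ G.edgeSet) ∧
  ∀ ⦃e f⦄, EdgeAdj G e f → φ e ≠ none → φ e ≠ φ f

/-- The partial coloring uses colors from `{0, ..., t-1}`. -/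
def UsesColors (φ : Sym2 V → Option ℕ) (t : ℕ) : Prop :=
  ∀ e a, φ e = some a → a < t

/-- The (total) coloring uses colors from `{0, ..., t-1}` on all edges of `G`. -/
def ColorsBelow (G : SimpleGraph V) (C : Sym2 V → ℕ) (t : ℕ) : Prop :=
  ∀ e ∈ G.edgeSet, C e < t

/-- `C` agrees with the partial coloring `φ` on all precolored edges. -/
def ExtendsColoring (C : Sym2 V → ℕ) (φ : Sym2 V → Option ℕ) : Prop :=
  ∀ e a, φ e = some a → C e = a

/-- `φ` extends to a proper edge coloring of `G` with `t` colors. -/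
def Extendable (G : SimpleGraph V) (φ : Sym2 V → Option ℕ) (t : ℕ) : Prop :=
  ∃ C, IsProperEdgeColoring G C ∧ ColorsBelow G C t ∧ ExtendsColoring C φ

/-- The set of precolored edges of `φ`. -/
def Precolored (φ : Sym2 V → Option ℕ) : Set (Sym2 V) := {e | φ e ≠ none}

/-- The chromatic index: least `t` admitting a proper edge coloring with `t` colors. -/
noncomputable def chromaticIndex (G : SimpleGraph V) : ℕ :=
  sInf {t | ∃ C, IsProperEdgeColoring G C ∧ ColorsBelow G C t}

/-- A set of edges is independent (a matching) if no two distinct members share a vertex. -/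
def IndependentEdges (S : Set (Sym2 V)) : Prop :=
  ∀ e ∈ S, ∀ f ∈ S, e ≠ f → ∀ v, v ∈ e → v ∉ f

/-- The colors of the two rails joining two consecutive rungs of the ladder. -/
abbrev RailState := ℕ × ℕ

/-- Prescribed colors of a rung and of the two rails following it; `3` means no prescription. -/
abbrev Column := ℕ × ℕ × ℕ

namespace Column

def states : List RailState :=
  [(0, 0), (0, 1), (0, 2), (0, 3), (1, 0), (1, 1), (1, 2), (1, 3),
    (2, 0), (2, 1), (2, 2), (2, 3), (3, 0), (3, 1), (3, 2), (3, 3)]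

def columns : List Column := [0, 1, 2, 3].product states

/-- The column without prescriptions. -/
def free : Column := (3, 3, 3)

/-- The color `x` is allowed by the prescription `c`. -/
def allows (c x : ℕ) : Bool := Nat.beq c 3 || Nat.beq c x

/-- The prescriptions `c` and `d` do not clash on adjacent edges. -/
def apart (c d : ℕ) : Bool := Nat.beq c 3 || Nat.beq d 3 || !Nat.beq c d

/-- The rails can change from state `s` to state `t` at a column with prescriptions `c`. -/
def step (c : Column) (s t : RailState) : Bool :=
  allows c.2.1 t.1 && allows c.2.2 t.2 && !Nat.beq s.1 t.1 && !Nat.beq s.2 t.2 &&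
    [0, 1, 2, 3].any fun r ↦ allows c.1 r && !Nat.beq r s.1 && !Nat.beq r s.2 &&
      !Nat.beq r t.1 && !Nat.beq r t.2

/-- The rails can change from state `s` to state `t` through the given columns. -/
def Path : List Column → RailState → RailState → Prop
  | [], s, t => s = t
  | c :: l, s, t => ∃ u ∈ states, step c s u = true ∧ Path l u t

/-- The columns, arranged cyclically, can be colored. -/
def Closed (l : List Column) : Prop := ∃ s ∈ states, Path l s s

/-- The number of prescriptions in a column. -/
def weight (c : Column) : ℕ :=
  (if c.1 = 3 then 0 else 1) + (if c.2.1 = 3 then 0 else 1) + (if c.2.2 = 3 then 0 else 1)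

/-- The prescriptions within a column do not clash. -/
def proper (c : Column) : Bool := apart c.1 c.2.1 && apart c.1 c.2.2

/-- The prescriptions of consecutive columns do not clash. -/
def compat (c d : Column) : Bool :=
  apart c.2.1 d.2.1 && apart c.2.2 d.2.2 && apart c.2.1 d.1 && apart c.2.2 d.1

/-- The prescriptions of columns separated by `k` free columns do not clash. -/
def link (k : ℕ) (c d : Column) : Bool := !Nat.beq k 0 || compat c d

/-- Each listed column, followed by the listed number of free columns. -/
def expand : List (Column × ℕ) → List Column
  | [] => []
  | (w, k) :: ps => w :: (List.replicate k free ++ expand ps)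

/-- A search for a path through `expand ps`, using that two free columns connect all states. -/
def search : List (Column × ℕ) → RailState → RailState → Bool
  | [], s, t => Nat.beq s.1 t.1 && Nat.beq s.2 t.2
  | (w, 0) :: ps, s, t => states.any fun u ↦ step w s u && search ps u t
  | (w, 1) :: ps, s, t => states.any fun u ↦ step w s u &&
      states.any fun v ↦ step free u v && search ps v t
  | (w, _ + 2) :: ps, s, t => states.any fun u ↦ step w s u &&
      states.any fun v ↦ search ps v t

def searchClosed (ps : List (Column × ℕ)) : Bool := states.any fun s ↦ search ps s s

/-- The properly prescribed columns with `k` prescriptions. -/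
def ofWeight (k : ℕ) : List Column := columns.filter fun c ↦ proper c && Nat.beq (weight c) k

theorem path_append {l l' : List Column} {s t : RailState} (hs : s ∈ states) :
    Path (l ++ l') s t ↔ ∃ u ∈ states, Path l s u ∧ Path l' u t := by
  induction l generalizing s with
  | nil => simp only [List.nil_append, Path]; exact ⟨fun h ↦ ⟨s, hs, rfl, h⟩, by
      rintro ⟨u, _, rfl, h⟩; exact h⟩
  | cons c l ih =>
    simp only [List.cons_append, Path]
    constructor
    · rintro ⟨v, hv, h, h'⟩
      obtain ⟨u, hu, h₁, h₂⟩ := (ih hv).1 h'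
      exact ⟨u, hu, ⟨v, hv, h, h₁⟩, h₂⟩
    · rintro ⟨u, hu, ⟨v, hv, h, h₁⟩, h₂⟩
      exact ⟨v, hv, h, (ih hv).2 ⟨u, hu, h₁, h₂⟩⟩

theorem Closed.of_isRotated {l l' : List Column} (h : Closed l) (hl : l ~r l') : Closed l' := by
  obtain ⟨k, rfl⟩ := hl
  rw [← List.rotate_mod]
  obtain hk | hk := Nat.eq_zero_or_pos l.length
  · rw [List.length_eq_zero_iff] at hk
    subst hk
    simpa using h
  rw [List.rotate_eq_drop_append_take (Nat.mod_lt _ hk).le]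
  obtain ⟨s, hs, h⟩ := h
  rw [← List.take_append_drop (k % l.length) l, path_append hs] at h
  obtain ⟨u, hu, h₁, h₂⟩ := h
  exact ⟨u, hu, (path_append hu).2 ⟨s, hs, h₂, h₁⟩⟩

theorem exists_step_free : ∀ s ∈ states, ∃ u ∈ states, step free s u = true := by
  decide +kernel

theorem exists_step_step_free : ∀ s ∈ states, ∀ t ∈ states,
    ∃ u ∈ states, step free s u = true ∧ step free u t = true := by
  decide +kernel

theorem path_replicate_free (k : ℕ) {s t : RailState} (hs : s ∈ states) (ht : t ∈ states) :
    Path (List.replicate (k + 2) free) s t := by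
  induction k generalizing s with
  | zero =>
    obtain ⟨u, hu, h₁, h₂⟩ := exists_step_step_free s hs t ht
    exact ⟨u, hu, h₁, t, ht, h₂, rfl⟩
  | succ k ih =>
    obtain ⟨u, hu, h⟩ := exists_step_free s hs
    exact ⟨u, hu, h, ih hu⟩

theorem path_of_search {ps : List (Column × ℕ)} {s t : RailState}
    (h : search ps s t = true) : Path (expand ps) s t := by
  fun_induction search ps s t with
  | case1 s t => simpa [Path, expand, Prod.ext_iff] using h
  | case2 s t w ps ih =>
    simp only [List.any_eq_true, Bool.and_eq_true] at h
    obtain ⟨u, hu, h₁, h₂⟩ := h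
    exact ⟨u, hu, h₁, ih _ h₂⟩
  | case3 s t w ps ih =>
    simp only [List.any_eq_true, Bool.and_eq_true] at h
    obtain ⟨u, hu, h₁, v, hv, h₂, h₃⟩ := h
    exact ⟨u, hu, h₁, v, hv, h₂, ih _ h₃⟩
  | case4 s t w k ps ih =>
    simp only [List.any_eq_true, Bool.and_eq_true] at h
    obtain ⟨u, hu, h₁, v, hv, h₂⟩ := h
    exact ⟨u, hu, h₁, (path_append hu).2 ⟨v, hv, path_replicate_free _ hu hv, ih _ h₂⟩⟩

theorem search_cap (ps : List (Column × ℕ)) (s t : RailState) :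
    search (ps.map fun p ↦ (p.1, min p.2 2)) s t = search ps s t := by
  fun_induction search ps s t with
  | case1 s t => rfl
  | case2 s t w ps ih | case3 s t w ps ih => simp [search, ih]
  | case4 s t w k ps ih => simp [search, ih]

theorem closed_of_searchClosed {ps : List (Column × ℕ)}
    (h : searchClosed (ps.map fun p ↦ (p.1, min p.2 2)) = true) : Closed (expand ps) := by
  simp only [searchClosed, search_cap, List.any_eq_true] at h
  obtain ⟨s, hs, h⟩ := h
  exact ⟨s, hs, path_of_search h⟩

theorem min_two_mem (k : ℕ) : min k 2 ∈ [0, 1, 2] := by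
  simp only [List.mem_cons, List.not_mem_nil, or_false]
  omega

theorem link_min (k : ℕ) (c d : Column) : link (min k 2) c d = link k c d := by
  rcases k with _ | k
  · rfl
  · obtain ⟨m, hm⟩ : ∃ m, min (k + 1) 2 = m + 1 := ⟨min k 1, by omega⟩
    rw [hm]; rfl

theorem searchClosed_one : ∀ w ∈ ofWeight 3, searchClosed [(w, 2)] = true :=
  List.all_eq_true.1 (by decide +kernel)

theorem searchClosed_two : ((ofWeight 2).all fun v ↦ (ofWeight 1).all fun w ↦
    [0, 1, 2].all fun i ↦ !link i v w || [0, 1, 2].all fun j ↦ !link j w v ||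
      (Nat.beq i j && !Nat.beq i 2) || searchClosed [(v, i), (w, j)]) = true := by
  decide +kernel

theorem searchClosed_three_of_gap : ((ofWeight 1).all fun u ↦ (ofWeight 1).all fun v ↦
    [0, 1, 2].all fun i ↦ !link i u v || (ofWeight 1).all fun w ↦
      [0, 1, 2].all fun j ↦ !link j v w || searchClosed [(u, i), (v, j), (w, 2)]) = true := by
  decide +kernel

theorem searchClosed_three_of_adjacent : ((ofWeight 1).all fun u ↦ (ofWeight 1).all fun v ↦
    !compat u v || (ofWeight 1).all fun w ↦ !compat v w || !compat w u ||
      searchClosed [(u, 0), (v, 0), (w, 0)]) = true := by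
  decide +kernel

theorem searchClosed_three_of_alternating : ((ofWeight 1).all fun u ↦ (ofWeight 1).all fun v ↦
    (ofWeight 1).all fun w ↦ !compat w u || searchClosed [(w, 0), (u, 1), (v, 1)]) = true := by
  decide +kernel


theorem closed_one {w : Column} (hw : w ∈ ofWeight 3) {k : ℕ} (hk : 2 ≤ k) :
    Closed (expand [(w, k)]) :=
  closed_of_searchClosed <| by simpa [hk] using searchClosed_one w hw

theorem closed_two {v w : Column} (hv : v ∈ ofWeight 2) (hw : w ∈ ofWeight 1) {i j : ℕ}
    (h : i ≠ j) (hi : link i v w = true) (hj : link j w v = true) :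
    Closed (expand [(v, i), (w, j)]) := by
  apply closed_of_searchClosed
  have := List.all_eq_true.1 (List.all_eq_true.1 searchClosed_two v hv) w hw
  have := List.all_eq_true.1 this _ (min_two_mem i)
  rw [link_min, hi] at this
  have := List.all_eq_true.1 this _ (min_two_mem j)
  rw [link_min, hj] at this
  simp only [Bool.not_true, Bool.false_or, Bool.or_eq_true, Bool.and_eq_true,
    Nat.beq_eq] at this
  obtain ⟨h₁, h₂⟩ | h' := this
  · rw [Bool.not_eq_true', ← Bool.not_eq_true, Nat.beq_eq] at h₂
    omega
  · exact h'

theorem closed_three_of_gap {u v w : Column} (hu : u ∈ ofWeight 1) (hv : v ∈ ofWeight 1)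
    (hw : w ∈ ofWeight 1) {i j k : ℕ} (hk : 2 ≤ k) (hi : link i u v = true)
    (hj : link j v w = true) : Closed (expand [(u, i), (v, j), (w, k)]) := by
  apply closed_of_searchClosed
  have := List.all_eq_true.1 (List.all_eq_true.1 searchClosed_three_of_gap u hu) v hv
  have := List.all_eq_true.1 this _ (min_two_mem i)
  rw [link_min, hi] at this
  have := List.all_eq_true.1 this w hw
  have := List.all_eq_true.1 this _ (min_two_mem j)
  rw [link_min, hj] at this
  simpa [hk] using this

theorem closed_three_of_adjacent {u v w : Column} (hu : u ∈ ofWeight 1) (hv : v ∈ ofWeight 1)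
    (hw : w ∈ ofWeight 1) (huv : compat u v = true) (hvw : compat v w = true)
    (hwu : compat w u = true) : Closed (expand [(u, 0), (v, 0), (w, 0)]) := by
  apply closed_of_searchClosed
  have := List.all_eq_true.1 (List.all_eq_true.1 searchClosed_three_of_adjacent u hu) v hv
  rw [huv] at this
  have := List.all_eq_true.1 this w hw
  simpa [hvw, hwu] using this

theorem closed_three_of_alternating {u v w : Column} (hu : u ∈ ofWeight 1)
    (hv : v ∈ ofWeight 1) (hw : w ∈ ofWeight 1) (hwu : compat w u = true) :
    Closed (expand [(w, 0), (u, 1), (v, 1)]) := by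
  apply closed_of_searchClosed
  have := List.all_eq_true.1 (List.all_eq_true.1 searchClosed_three_of_alternating u hu) v hv
  have := List.all_eq_true.1 this w hw
  simpa [hwu] using this

theorem expand_append (ps qs : List (Column × ℕ)) :
    expand (ps ++ qs) = expand ps ++ expand qs := by
  induction ps with
  | nil => rfl
  | cons p ps ih => obtain ⟨w, k⟩ := p; simp [expand, ih]

theorem expand_isRotated {ps qs : List (Column × ℕ)} (h : ps ~r qs) :
    expand ps ~r expand qs := by
  obtain ⟨k, rfl⟩ := h
  rw [← List.rotate_mod]
  obtain hk | hk := Nat.eq_zero_or_pos ps.length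
  · rw [List.length_eq_zero_iff] at hk
    subst hk
    simp [List.IsRotated.refl]
  rw [List.rotate_eq_drop_append_take (Nat.mod_lt _ hk).le, expand_append]
  conv_lhs => rw [← List.take_append_drop (k % ps.length) ps, expand_append]
  exact List.isRotated_append

/-- No prescriptions of cyclically consecutive columns clash. -/
def CyclicCompat (l : List Column) : Prop :=
  ∀ ⦃a b r⦄, l ~r a :: b :: r → compat a b = true

theorem CyclicCompat.link {p q : Column × ℕ} {ps qs : List (Column × ℕ)}
    (h : CyclicCompat (expand ps)) (hps : ps ~r p :: q :: qs) :
    link p.2 p.1 q.1 = true := by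
  obtain ⟨p, k⟩ := p
  obtain ⟨q, k'⟩ := q
  rcases k with _ | k
  · have := h (expand_isRotated hps)
    simpa [Column.link] using this
  · rfl

theorem closed_three {u v w : Column} (hu : u ∈ ofWeight 1) (hv : v ∈ ofWeight 1)
    (hw : w ∈ ofWeight 1) {i j k : ℕ}
    (hodd : Odd (expand [(u, i), (v, j), (w, k)]).length)
    (hc : CyclicCompat (expand [(u, i), (v, j), (w, k)])) :
    Closed (expand [(u, i), (v, j), (w, k)]) := by
  have h₁ : [(u, i), (v, j), (w, k)] ~r [(v, j), (w, k), (u, i)] := ⟨1, rfl⟩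
  have h₂ : [(u, i), (v, j), (w, k)] ~r [(w, k), (u, i), (v, j)] := ⟨2, rfl⟩
  have hi := hc.link (List.IsRotated.refl _)
  have hj := hc.link h₁
  have hk := hc.link h₂
  by_cases hk2 : 2 ≤ k
  · exact closed_three_of_gap hu hv hw hk2 hi hj
  by_cases hi2 : 2 ≤ i
  · exact (closed_three_of_gap hv hw hu hi2 hj hk).of_isRotated (expand_isRotated h₁.symm)
  by_cases hj2 : 2 ≤ j
  · exact (closed_three_of_gap hw hu hv hj2 hk hi).of_isRotated (expand_isRotated h₂.symm)
  have hsum : Odd (i + j + k + 3) := by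
    convert hodd using 1
    simp [expand]
    ring
  interval_cases k <;> interval_cases i <;> interval_cases j <;>
    first
    | exact absurd hsum (by decide)
    | skip
  · exact closed_three_of_adjacent hu hv hw hi hj hk
  · exact (closed_three_of_alternating hu hv hw hk).of_isRotated (expand_isRotated h₂.symm)
  · exact closed_three_of_alternating hv hw hu hi
  · exact (closed_three_of_alternating hw hu hv hj).of_isRotated (expand_isRotated h₁.symm)

theorem exists_expand_eq (w : Column) (l : List Column) (hw : w ≠ free) :
    ∃ k ps, w :: l = expand ((w, k) :: ps) ∧ ∀ p ∈ ps, p.1 ≠ free := by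
  induction l generalizing w with
  | nil => exact ⟨0, [], rfl, by simp⟩
  | cons c l ih =>
    by_cases hc : c = free
    · obtain ⟨k, ps, h, hps⟩ := ih w hw
      refine ⟨k + 1, ps, ?_, hps⟩
      simp only [expand, List.cons.injEq, true_and] at h
      simp [expand, h, hc, List.replicate_succ]
    · obtain ⟨k, ps, h, hps⟩ := ih c hc
      refine ⟨0, (c, k) :: ps, by rw [h]; rfl, ?_⟩
      simpa [hc] using hps

theorem weight_eq_zero {c : Column} : weight c = 0 ↔ c = free := by
  obtain ⟨r, a, b⟩ := c
  simp only [weight, free, Prod.mk.injEq, Nat.add_eq_zero_iff]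
  split_ifs <;> simp_all

theorem sum_weight_expand (ps : List (Column × ℕ)) :
    ((expand ps).map weight).sum = (ps.map fun p ↦ weight p.1).sum := by
  induction ps with
  | nil => rfl
  | cons p ps ih =>
    obtain ⟨w, k⟩ := p
    simp [expand, ih, weight_eq_zero.2 rfl]

theorem mem_expand {p : Column × ℕ} {ps : List (Column × ℕ)} (h : p ∈ ps) :
    p.1 ∈ expand ps := by
  induction ps with
  | nil => simp at h
  | cons q ps ih =>
    obtain ⟨w, k⟩ := q
    obtain rfl | h := List.mem_cons.1 h
    · simp [expand]
    · simp [expand, ih h]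

theorem closed_of_sum_weight_eq_three {l : List Column}
    (hl : ∀ c ∈ l, c ∈ columns ∧ proper c = true) (hw : (l.map weight).sum = 3)
    (hlen : 3 ≤ l.length) (hodd : Odd l.length) (hc : CyclicCompat l) : Closed l := by
  obtain ⟨w, hwl, hwf⟩ : ∃ w ∈ l, w ≠ free := by
    by_contra! h
    have : (l.map weight).sum = 0 := by
      refine List.sum_eq_zero fun k hk ↦ ?_
      obtain ⟨c, hc, rfl⟩ := List.mem_map.1 hk
      exact weight_eq_zero.2 (h c hc)
    omega
  obtain ⟨x, y, rfl⟩ := List.append_of_mem hwl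
  have hrot : x ++ w :: y ~r w :: (y ++ x) := List.isRotated_append
  obtain ⟨k, ps, hps, hf⟩ := exists_expand_eq w (y ++ x) hwf
  rw [hps] at hrot
  refine Closed.of_isRotated ?_ hrot.symm
  replace hf : ∀ p ∈ (w, k) :: ps, p.1 ≠ free := by simpa [hwf] using hf
  replace hl : ∀ p ∈ (w, k) :: ps, p.1 ∈ ofWeight (weight p.1) := fun p hp ↦ by
    simpa [ofWeight] using hl p.1 (hrot.mem_iff.2 (mem_expand hp))
  rw [(hrot.perm.map weight).sum_eq, sum_weight_expand] at hw
  rw [hrot.perm.length_eq] at hlen hodd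
  replace hc : CyclicCompat (expand ((w, k) :: ps)) := fun a b r h ↦ hc (hrot.trans h)
  generalize (w, k) :: ps = qs at *
  have hpos : ∀ p ∈ qs, 0 < weight p.1 := fun p hp ↦
    Nat.pos_of_ne_zero fun h ↦ hf p hp (weight_eq_zero.1 h)
  match qs with
  | [] => simp at hw
  | [(u, i)] =>
    simp only [List.forall_mem_cons, List.map_cons, List.map_nil, List.sum_cons, List.sum_nil,
      add_zero] at hl hw
    rw [hw] at hl
    refine closed_one hl.1 ?_
    simp [expand] at hlen
    omega
  | [(u, i), (v, j)] =>
    simp only [List.forall_mem_cons, List.map_cons, List.map_nil, List.sum_cons, List.sum_nil,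
      add_zero] at hl hw hpos
    have hrot : [(u, i), (v, j)] ~r [(v, j), (u, i)] := ⟨1, rfl⟩
    have hi := hc.link (List.IsRotated.refl _)
    have hj := hc.link hrot
    have hij : i ≠ j := by
      rintro rfl
      simp [expand] at hodd
      grind
    obtain ⟨h₁, h₂⟩ | ⟨h₁, h₂⟩ : weight u = 2 ∧ weight v = 1 ∨ weight u = 1 ∧ weight v = 2 := by
      omega
    · rw [h₁, h₂] at hl
      exact closed_two hl.1 hl.2.1 hij hi hj
    · rw [h₁, h₂] at hl
      exact (closed_two hl.2.1 hl.1 hij.symm hj hi).of_isRotated (expand_isRotated hrot.symm)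
  | [(u, i), (v, j), (x, m)] =>
    simp only [List.forall_mem_cons, List.map_cons, List.map_nil, List.sum_cons, List.sum_nil,
      add_zero] at hl hw hpos
    obtain ⟨h₁, h₂, h₃⟩ : weight u = 1 ∧ weight v = 1 ∧ weight x = 1 := by omega
    rw [h₁, h₂, h₃] at hl
    exact closed_three hl.1 hl.2.1 hl.2.2.1 hodd hc
  | p :: q :: r :: s :: qs =>
    simp only [List.forall_mem_cons, List.map_cons, List.sum_cons] at hw hpos
    omega

theorem Path.exists_fun {l : List Column} {s t : RailState} (h : Path l s t) (hs : s ∈ states) :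
    ∃ f : ℕ → RailState, f 0 = s ∧ f l.length = t ∧ (∀ i, f i ∈ states) ∧
      ∀ i (hi : i < l.length), step l[i] (f i) (f (i + 1)) = true := by
  induction l generalizing s with
  | nil => exact ⟨fun _ ↦ s, rfl, h, fun _ ↦ hs, by simp⟩
  | cons c l ih =>
    obtain ⟨u, hu, h₁, h₂⟩ := h
    obtain ⟨f, rfl, hf, hf', hf''⟩ := ih h₂ hu
    refine ⟨fun i ↦ Nat.casesOn i s f, rfl, hf, ?_, ?_⟩
    · rintro (_ | i)
      exacts [hs, hf' i]
    · rintro (_ | i) hi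
      exacts [h₁, hf'' i (by simpa using hi)]

end Column

section Ladder

variable {m : ℕ} [NeZero m]

/-- The edges of the circular ladder: rungs are indexed by `(i, none)` and rails by
`(i, some j)`. -/
def ladderEdge : Fin m × Option (Fin 2) → Sym2 (Fin m × Fin 2)
  | (i, none) => s((i, 0), (i, 1))
  | (i, some j) => s((i, j), (i + 1, j))

theorem Fin.one_ne_zero_of_three_le (hm : 3 ≤ m) : (1 : Fin m) ≠ 0 := by
  rw [Ne, Fin.ext_iff, Fin.val_one', Fin.val_zero, Nat.mod_eq_of_lt (by omega)]
  omega

theorem Fin.one_add_one_ne_zero_of_three_le (hm : 3 ≤ m) : (1 + 1 : Fin m) ≠ 0 := by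
  rw [Ne, Fin.ext_iff, Fin.val_add, Fin.val_one', Fin.val_zero,
    Nat.mod_eq_of_lt (a := 1) (by omega), Nat.mod_eq_of_lt (by omega)]
  omega

theorem ladderEdge_injective (hm : 3 ≤ m) :
    Function.Injective (ladderEdge : Fin m × Option (Fin 2) → _) := by
  have h1 := Fin.one_ne_zero_of_three_le hm
  have h2 := Fin.one_add_one_ne_zero_of_three_le hm
  rintro ⟨i, _ | j⟩ ⟨i', _ | j'⟩ h
  · simpa [ladderEdge] using h
  · simp only [ladderEdge, Sym2.eq_iff, Prod.mk.injEq] at h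
    rcases h with ⟨⟨_, h⟩, _, h'⟩ | ⟨⟨_, h⟩, _, h'⟩ <;> simp [← h] at h'
  · simp only [ladderEdge, Sym2.eq_iff, Prod.mk.injEq] at h
    rcases h with ⟨⟨_, h⟩, _, h'⟩ | ⟨⟨_, h⟩, _, h'⟩ <;> simp [h] at h'
  · simp only [ladderEdge, Sym2.eq_iff, Prod.mk.injEq] at h
    rcases h with ⟨⟨rfl, rfl⟩, _⟩ | ⟨⟨rfl, _⟩, h, _⟩
    · rfl
    · rw [add_assoc, add_eq_left] at h
      exact absurd h h2

theorem eq_of_mem_ladderEdge {x : Fin m × Option (Fin 2)} {k : Fin m} {j : Fin 2}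
    (h : (k, j) ∈ ladderEdge x) :
    x = (k, none) ∨ x = (k, some j) ∨ x = (k - 1, some j) := by
  obtain ⟨i, _ | j'⟩ := x <;> simp only [ladderEdge, Sym2.mem_iff, Prod.mk.injEq] at h
  · rcases h with ⟨rfl, _⟩ | ⟨rfl, _⟩ <;> simp
  · rcases h with ⟨rfl, rfl⟩ | ⟨rfl, rfl⟩ <;> simp

theorem mem_edgeSet_ladder_iff (hm : 3 ≤ m) {e : Sym2 (Fin m × Fin 2)} :
    e ∈ ((cycleGraph m).boxProd (⊤ : SimpleGraph (Fin 2))).edgeSet ↔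
      ∃ x, ladderEdge x = e := by
  have h1 : (1 : Fin m).val = 1 := by rw [Fin.val_one', Nat.mod_eq_of_lt (by omega)]
  have hadj (a b : Fin m) : (cycleGraph m).Adj a b ↔ a = b + 1 ∨ b = a + 1 := by
    rw [cycleGraph_adj', ← h1, ← Fin.ext_iff, ← Fin.ext_iff, sub_eq_iff_eq_add',
      sub_eq_iff_eq_add']
  constructor
  · induction e with
    | h a b =>
    obtain ⟨a, j⟩ := a
    obtain ⟨b, j'⟩ := b
    simp only [mem_edgeSet, boxProd_adj, hadj, top_adj]
    rintro (⟨rfl | rfl, rfl⟩ | ⟨h, rfl⟩)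
    · exact ⟨(b, some j), Sym2.eq_swap⟩
    · exact ⟨(a, some j), rfl⟩
    · refine ⟨(a, none), ?_⟩
      fin_cases j <;> fin_cases j'
      · simp at h
      · rfl
      · exact Sym2.eq_swap
      · simp at h
  · rintro ⟨⟨i, _ | j⟩, rfl⟩ <;> simp [ladderEdge, hadj]

theorem isProperEdgeColoring_ladder (hm : 3 ≤ m) {C : Sym2 (Fin m × Fin 2) → ℕ}
    (h₁ : ∀ k j, C (ladderEdge (k, none)) ≠ C (ladderEdge (k, some j)))
    (h₂ : ∀ k j, C (ladderEdge (k, none)) ≠ C (ladderEdge (k - 1, some j)))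
    (h₃ : ∀ k j, C (ladderEdge (k, some j)) ≠ C (ladderEdge (k - 1, some j))) :
    IsProperEdgeColoring ((cycleGraph m).boxProd (⊤ : SimpleGraph (Fin 2))) C := by
  rintro e f ⟨he, hf, hne, ⟨k, j⟩, hve, hvf⟩
  obtain ⟨x, rfl⟩ := (mem_edgeSet_ladder_iff hm).1 he
  obtain ⟨y, rfl⟩ := (mem_edgeSet_ladder_iff hm).1 hf
  rcases eq_of_mem_ladderEdge hve with rfl | rfl | rfl <;>
    rcases eq_of_mem_ladderEdge hvf with rfl | rfl | rfl
  exacts [absurd rfl hne, h₁ k j, h₂ k j, (h₁ k j).symm, absurd rfl hne, h₃ k j,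
    (h₂ k j).symm, (h₃ k j).symm, absurd rfl hne]

/-- The color prescribed by `φ` to an edge, or `3`. -/
def prescription (φ : Sym2 (Fin m × Fin 2) → Option ℕ) (x : Fin m × Option (Fin 2)) : ℕ :=
  (φ (ladderEdge x)).getD 3

/-- The prescriptions of `φ` at the `i`-th rung and the two rails following it. -/
def ladderColumn (φ : Sym2 (Fin m × Fin 2) → Option ℕ) (i : Fin m) : Column :=
  (prescription φ (i, none), prescription φ (i, some 0), prescription φ (i, some 1))

variable {φ : Sym2 (Fin m × Fin 2) → Option ℕ}

theorem prescription_eq_three_iff (hc : UsesColors φ 3) {x : Fin m × Option (Fin 2)} :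
    prescription φ x = 3 ↔ φ (ladderEdge x) = none := by
  unfold prescription
  rcases h : φ (ladderEdge x) with _ | a
  · simp
  · simpa using (hc _ _ h).ne

theorem prescription_lt (hc : UsesColors φ 3) (x : Fin m × Option (Fin 2)) :
    prescription φ x < 4 := by
  unfold prescription
  rcases h : φ (ladderEdge x) with _ | a
  · simp
  · simpa using (hc _ _ h).trans (by norm_num)

theorem apart_prescription (hm : 3 ≤ m)
    (hφ : IsPartialProperEdgeColoring ((cycleGraph m).boxProd (⊤ : SimpleGraph (Fin 2))) φ)
    {x y : Fin m × Option (Fin 2)} (hxy : x ≠ y) {v : Fin m × Fin 2} (hx : v ∈ ladderEdge x)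
    (hy : v ∈ ladderEdge y) :
    Column.apart (prescription φ x) (prescription φ y) = true := by
  have h := hφ.2 ⟨(mem_edgeSet_ladder_iff hm).2 ⟨x, rfl⟩, (mem_edgeSet_ladder_iff hm).2 ⟨y, rfl⟩,
    (ladderEdge_injective hm).ne hxy, v, hx, hy⟩
  unfold prescription
  rcases h₁ : φ (ladderEdge x) with _ | a
  · rfl
  rcases h₂ : φ (ladderEdge y) with _ | b
  · simp [Column.apart]
  rw [h₁, h₂] at h
  have hab : a ≠ b := by simpa using h
  have : Nat.beq a b = false := by rwa [← Bool.not_eq_true, Nat.beq_eq]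
  simp [Column.apart, this]

theorem Column.mem_columns {c : Column} (h₁ : c.1 < 4) (h₂ : c.2.1 < 4) (h₃ : c.2.2 < 4) :
    c ∈ columns := by
  obtain ⟨r, a, b⟩ := c
  dsimp only at h₁ h₂ h₃
  interval_cases r <;> interval_cases a <;> interval_cases b <;> decide

theorem proper_ladderColumn (hm : 3 ≤ m)
    (hφ : IsPartialProperEdgeColoring ((cycleGraph m).boxProd (⊤ : SimpleGraph (Fin 2))) φ)
    (i : Fin m) : (ladderColumn φ i).proper = true := by
  have h (j : Fin 2) := apart_prescription hm hφ (x := (i, none)) (y := (i, some j))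
    (by simp) (v := (i, j)) (by fin_cases j <;> simp [ladderEdge]) (by simp [ladderEdge])
  simp [Column.proper, ladderColumn, h]

theorem compat_ladderColumn (hm : 3 ≤ m)
    (hφ : IsPartialProperEdgeColoring ((cycleGraph m).boxProd (⊤ : SimpleGraph (Fin 2))) φ)
    (i : Fin m) : (ladderColumn φ i).compat (ladderColumn φ (i + 1)) = true := by
  have h (j : Fin 2) := apart_prescription hm hφ (x := (i, some j)) (y := (i + 1, none))
    (by simp) (v := (i + 1, j)) (by simp [ladderEdge]) (by fin_cases j <;> simp [ladderEdge])
  have h' (j : Fin 2) := apart_prescription hm hφ (x := (i, some j)) (y := (i + 1, some j))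
    (by simp [Fin.one_ne_zero_of_three_le hm]) (v := (i + 1, j)) (by simp [ladderEdge])
    (by simp [ladderEdge])
  simp [Column.compat, ladderColumn, h, h']

theorem List.exists_of_ofFn_isRotated {α : Type*} {c : Fin m → α} {a b : α} {r : List α}
    (h : List.ofFn c ~r a :: b :: r) : ∃ i, c i = a ∧ c (i + 1) = b := by
  obtain ⟨k, h⟩ := h
  have hlen : m = r.length + 2 := by simpa using congrArg List.length h
  have h₀ : ((List.ofFn c).rotate k)[0]? = some a := by rw [h]; rfl
  have h₁ : ((List.ofFn c).rotate k)[1]? = some b := by rw [h]; rfl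
  rw [List.getElem?_rotate (by simp; omega), List.getElem?_ofFn] at h₀ h₁
  simp only [List.length_ofFn, Nat.mod_lt _ (NeZero.pos m), dite_true, Option.some.injEq,
    zero_add] at h₀ h₁
  refine ⟨_, h₀, ?_⟩
  rw [← h₁]
  congr 1
  ext
  simp [Fin.val_add, add_comm]

theorem sum_weight_ladderColumn (hm : 3 ≤ m) (hc : UsesColors φ 3)
    (hφ : IsPartialProperEdgeColoring ((cycleGraph m).boxProd (⊤ : SimpleGraph (Fin 2))) φ) :
    ∑ i, (ladderColumn φ i).weight = (Precolored φ).ncard := by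
  have h : Precolored φ = ladderEdge ''
      (Finset.univ.filter fun x : Fin m × Option (Fin 2) ↦ prescription φ x ≠ 3) := by
    ext e
    simp only [Precolored, Set.mem_ofPred_eq, Finset.coe_filter, Finset.mem_univ, true_and,
      Set.mem_image, ne_eq, prescription_eq_three_iff hc]
    constructor
    · intro he
      obtain ⟨x, rfl⟩ := (mem_edgeSet_ladder_iff hm).1 (hφ.1 e he)
      exact ⟨x, he, rfl⟩
    · rintro ⟨x, hx, rfl⟩
      exact hx
  rw [h, Set.ncard_image_of_injective _ (ladderEdge_injective hm), Set.ncard_coe_finset,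
    Finset.card_filter, Fintype.sum_prod_type]
  refine Finset.sum_congr rfl fun i _ ↦ ?_
  simp [Column.weight, ladderColumn, Fintype.sum_option, Fin.sum_univ_two, ite_not, add_assoc]
  rfl

theorem closed_ladderColumn (hm : 3 ≤ m) (hodd : Odd m)
    (hφ : IsPartialProperEdgeColoring ((cycleGraph m).boxProd (⊤ : SimpleGraph (Fin 2))) φ)
    (hc : UsesColors φ 3) (hcard : (Precolored φ).ncard = 3) :
    Column.Closed (List.ofFn (ladderColumn φ)) := by
  apply Column.closed_of_sum_weight_eq_three
  · intro c h
    obtain ⟨i, rfl⟩ := (List.mem_ofFn' _ _).1 h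
    exact ⟨Column.mem_columns (prescription_lt hc _) (prescription_lt hc _)
      (prescription_lt hc _), proper_ladderColumn hm hφ i⟩
  · rw [List.map_ofFn, List.sum_ofFn, ← hcard, ← sum_weight_ladderColumn hm hc hφ]
    rfl
  · simpa using hm
  · simpa using hodd
  · intro a b r h
    obtain ⟨i, rfl, rfl⟩ := List.exists_of_ofFn_isRotated h
    exact compat_ladderColumn hm hφ i

theorem Column.step_iff {c : Column} {s t : RailState} :
    step c s t = true ↔ (c.2.1 = 3 ∨ c.2.1 = t.1) ∧ (c.2.2 = 3 ∨ c.2.2 = t.2) ∧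
      s.1 ≠ t.1 ∧ s.2 ≠ t.2 ∧ ∃ r < 4, (c.1 = 3 ∨ c.1 = r) ∧ r ≠ s.1 ∧ r ≠ s.2 ∧
        r ≠ t.1 ∧ r ≠ t.2 := by
  have h (a b : ℕ) : Nat.beq a b = false ↔ a ≠ b := by
    rw [← Bool.not_eq_true, Nat.beq_eq]
  have h' (r : ℕ) : r ∈ [0, 1, 2, 3] ↔ r < 4 := by
    simp only [List.mem_cons, List.not_mem_nil, or_false]
    omega
  simp only [step, allows, Bool.and_eq_true, Bool.or_eq_true, Nat.beq_eq, Bool.not_eq_true', h,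
    List.any_eq_true, h', and_assoc]

theorem Column.lt_of_mem_states {s : RailState} (hs : s ∈ states) : s.1 < 4 ∧ s.2 < 4 := by
  revert s
  decide

theorem exists_ladder_coloring (hm : 3 ≤ m) (h : Column.Closed (List.ofFn (ladderColumn φ))) :
    ∃ col : Fin m × Option (Fin 2) → ℕ, (∀ x, col x < 4) ∧
      (∀ x, prescription φ x = 3 ∨ prescription φ x = col x) ∧
      ∀ k j, col (k, none) ≠ col (k, some j) ∧ col (k, none) ≠ col (k - 1, some j) ∧
        col (k, some j) ≠ col (k - 1, some j) := by
  obtain ⟨s, hs, h⟩ := h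
  obtain ⟨f, hf₀, hfm, hf, hstep⟩ := h.exists_fun hs
  rw [List.length_ofFn] at hfm
  have hstep (i : Fin m) : Column.step (ladderColumn φ i) (f i) (f (i + 1)) = true := by
    simpa using hstep i (by simp)
  simp only [Column.step_iff] at hstep
  choose h₁ h₂ h₃ h₄ r hr h₅ h₆ h₇ h₈ h₉ using hstep
  have hprev (k : Fin m) : f ((k - 1 : Fin m).val + 1) = f k := by
    by_cases hk : k = 0
    · subst hk
      have : (0 - 1 : Fin m).val + 1 = m := by
        rw [zero_sub, Fin.val_neg', Fin.val_one', Nat.mod_eq_of_lt (a := 1) (by omega),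
          Nat.mod_eq_of_lt (by omega)]
        omega
      rw [this, hfm, Fin.val_zero, hf₀]
    · have hk' : 0 < k.val := Nat.pos_of_ne_zero fun h ↦ hk (Fin.ext h)
      have h1 : (1 : Fin m).val = 1 := by rw [Fin.val_one', Nat.mod_eq_of_lt (by omega)]
      have : (k - 1 : Fin m).val + 1 = k := by
        rw [Fin.sub_val_of_le (by rw [Fin.le_def, h1]; exact hk'), h1]
        omega
      rw [this]
  have hlt (i : ℕ) := Column.lt_of_mem_states (hf i)
  refine ⟨fun x ↦ x.2.elim (r x.1) ![(f (x.1 + 1)).1, (f (x.1 + 1)).2], ?_, ?_, ?_⟩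
  · rintro ⟨i, _ | j⟩
    · exact hr i
    · fin_cases j
      exacts [(hlt _).1, (hlt _).2]
  · rintro ⟨i, _ | j⟩
    · exact h₅ i
    · fin_cases j
      exacts [h₁ i, h₂ i]
  · intro k j
    fin_cases j
    · exact ⟨h₈ k, by simpa [hprev] using h₆ k, by simpa [hprev] using (h₃ k).symm⟩
    · exact ⟨h₉ k, by simpa [hprev] using h₇ k, by simpa [hprev] using (h₄ k).symm⟩

theorem extendable_ladder (hm : 3 ≤ m) (hodd : Odd m)
    (hφ : IsPartialProperEdgeColoring ((cycleGraph m).boxProd (⊤ : SimpleGraph (Fin 2))) φ)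
    (hc : UsesColors φ 3) (hcard : (Precolored φ).ncard = 3) :
    Extendable ((cycleGraph m).boxProd (⊤ : SimpleGraph (Fin 2))) φ 4 := by
  obtain ⟨col, hlt, hpre, hcol⟩ :=
    exists_ladder_coloring hm (closed_ladderColumn hm hodd hφ hc hcard)
  have hC (x) : Function.extend ladderEdge col 0 (ladderEdge x) = col x :=
    (ladderEdge_injective hm).extend_apply _ _ _
  refine ⟨Function.extend ladderEdge col 0, isProperEdgeColoring_ladder hm ?_ ?_ ?_, ?_, ?_⟩
  · simpa only [hC] using fun k j ↦ (hcol k j).1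
  · simpa only [hC] using fun k j ↦ (hcol k j).2.1
  · simpa only [hC] using fun k j ↦ (hcol k j).2.2
  · intro e he
    obtain ⟨x, rfl⟩ := (mem_edgeSet_ladder_iff hm).1 he
    exact (hC x).trans_lt (hlt x)
  · intro e a ha
    obtain ⟨x, rfl⟩ := (mem_edgeSet_ladder_iff hm).1 (hφ.1 e (by simp [ha]))
    rw [hC]
    have h := (hpre x).resolve_left fun h ↦ by simp [(prescription_eq_three_iff hc).1 h] at ha
    rw [← h, prescription, ha, Option.getD_some]

end Ladder

theorem stmt17 (n : ℕ) (hn : 1 ≤ n) (φ : Sym2 (Fin (2*n+1) × Fin 2) → Option ℕ)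
    (hφ : IsPartialProperEdgeColoring ((cycleGraph (2*n+1)).boxProd (⊤ : SimpleGraph (Fin 2))) φ)
    (hc : UsesColors φ 3) (hcard : (Precolored φ).ncard = 3) :
    Extendable ((cycleGraph (2*n+1)).boxProd (⊤ : SimpleGraph (Fin 2))) φ 4 :=
  extendable_ladder (by omega) ⟨n, rfl⟩ hφ hc hcard
end

section
/- Let G be a Class 1 graph with maximum degree 3 such that every partial proper edge coloring of at most 2 edges of G using 3 colors extends to a proper 3-edge coloring of G. Then every partial proper edge coloring of at most 3 edges of G □ K_2 using 4 colors extends to a proper 4-edge coloring of G □ K_2. -/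
open SimpleGraph

variable {V : Type*}

/-- `f`, read on the edges of `G`, is a proper edge coloring that never uses the color `d`. -/
structure IsColoringAvoiding (G : SimpleGraph V) (d : Fin 4) (f : V → V → Fin 4) : Prop where
  symm : ∀ u v, f u v = f v u
  proper : ∀ u v w, G.Adj u v → G.Adj u w → f u v = f u w → v = w
  avoids : ∀ u v, G.Adj u v → f u v ≠ d

/-- `c₀` and `c₁` color the two copies of `G` and `p` colors the matching edges, giving
a proper edge coloring of `G □ K₂`. -/
structure IsPrismColoring (G : SimpleGraph V) (c₀ c₁ : V → V → Fin 4) (p : V → Fin 4) :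
    Prop where
  symm₀ : ∀ u v, c₀ u v = c₀ v u
  symm₁ : ∀ u v, c₁ u v = c₁ v u
  proper₀ : ∀ u v w, G.Adj u v → G.Adj u w → c₀ u v = c₀ u w → v = w
  proper₁ : ∀ u v w, G.Adj u v → G.Adj u w → c₁ u v = c₁ u w → v = w
  ne₀ : ∀ u v, G.Adj u v → p u ≠ c₀ u v
  ne₁ : ∀ u v, G.Adj u v → p u ≠ c₁ u v

theorem IsPrismColoring.swap {G : SimpleGraph V} {c₀ c₁ : V → V → Fin 4} {p : V → Fin 4}
    (h : IsPrismColoring G c₀ c₁ p) : IsPrismColoring G c₁ c₀ p :=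
  ⟨h.symm₁, h.symm₀, h.proper₁, h.proper₀, h.ne₁, h.ne₀⟩

/-- The pairs `ab` and `a'b'` are the same edge. -/
def SameEdge (a b a' b' : V) : Prop := (a = a' ∧ b = b') ∨ (a = b' ∧ b = a')

/-- The pairs `ab` and `a'b'` have no common vertex. -/
def DisjointEdge (a b a' b' : V) : Prop := a ≠ a' ∧ a ≠ b' ∧ b ≠ a' ∧ b ≠ b'

/-- Coloring `ab` with `α` and `a'b'` with `α'` creates no conflict. -/
def Compatible (a b : V) (α : Fin 4) (a' b' : V) (α' : Fin 4) : Prop :=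
  (SameEdge a b a' b' → α = α') ∧ (α = α' → SameEdge a b a' b' ∨ DisjointEdge a b a' b')

theorem Compatible.symm {a b a' b' : V} {α α' : Fin 4} (h : Compatible a b α a' b' α') :
    Compatible a' b' α' a b α := by
  unfold Compatible SameEdge DisjointEdge at *
  grind

theorem Compatible.refl (a b : V) (α : Fin 4) : Compatible a b α a b α := by
  unfold Compatible SameEdge
  grind

/-- Any two compatible color requests are met by a 3-edge-coloring of `G`, for each choice of the
three colors among four. -/
def TwoExtendable (G : SimpleGraph V) : Prop :=
  ∀ (d : Fin 4) (a b : V) (α : Fin 4) (a' b' : V) (α' : Fin 4), α ≠ d → α' ≠ d →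
    (G.Adj a b → G.Adj a' b' → Compatible a b α a' b' α') →
    ∃ f, IsColoringAvoiding G d f ∧ (G.Adj a b → f a b = α) ∧ (G.Adj a' b' → f a' b' = α')

theorem exists_fin_four_ne (x y z : Fin 4) : ∃ β : Fin 4, β ≠ x ∧ β ≠ y ∧ β ≠ z := by
  decide +revert

theorem twoExtendable_of_extendable [Fintype V] (G : SimpleGraph V)
    (hext : ∀ φ : Sym2 V → Option ℕ, IsPartialProperEdgeColoring G φ →
      UsesColors φ 3 → (Precolored φ).ncard ≤ 2 → Extendable G φ 3) : TwoExtendable G := by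
  classical
  intro d a b α a' b' α' hα hα' hc
  obtain ⟨i, rfl⟩ := Fin.exists_succAbove_eq hα
  obtain ⟨j, rfl⟩ := Fin.exists_succAbove_eq hα'
  let φ : Sym2 V → Option ℕ := fun e =>
    if e = s(a, b) ∧ G.Adj a b then some i.val
    else if e = s(a', b') ∧ G.Adj a' b' then some j.val else none
  have hφ : IsPartialProperEdgeColoring G φ := by
    refine ⟨?_, ?_⟩
    · intro e he
      by_cases h1 : e = s(a, b) ∧ G.Adj a b
      · rw [h1.1]; exact h1.2
      · by_cases h2 : e = s(a', b') ∧ G.Adj a' b'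
        · rw [h2.1]; exact h2.2
        · simp [φ, h1, h2] at he
    · rintro e f ⟨_, _, hne, v, hve, hvf⟩ he heq
      have key : G.Adj a b → G.Adj a' b' → s(a, b) ≠ s(a', b') → ∀ v, v ∈ s(a, b) →
          v ∈ s(a', b') → (i : ℕ) ≠ j := by
        intro h1 h2 hne v hv hv' hij
        have := (hc h1 h2).2 (by rw [Fin.ext hij])
        simp only [Sym2.mem_iff, ne_eq, Sym2.eq_iff] at hv hv' hne
        unfold SameEdge DisjointEdge at this
        grind
      simp only [φ] at he heq
      split_ifs at he heq <;> grind
  have hcol : UsesColors φ 3 := by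
    intro e c h
    simp only [φ] at h
    split_ifs at h <;> simp at h <;> omega
  have hcard : (Precolored φ).ncard ≤ 2 := by
    refine le_trans (Set.ncard_le_ncard (t := {s(a, b), s(a', b')}) ?_ (Set.toFinite _))
      ((Set.ncard_insert_le _ _).trans (by simp))
    intro e he
    simp only [Precolored, Set.mem_ofPred_eq, φ] at he
    split_ifs at he <;> simp_all
  obtain ⟨C, hC, hlt, hCφ⟩ := hext φ hφ hcol hcard
  have hlt' : ∀ u v, G.Adj u v → C s(u, v) < 3 := fun u v h => hlt _ h
  refine ⟨fun u v => d.succAbove (Fin.ofNat 3 (C s(u, v))), ⟨?_, ?_, ?_⟩, ?_, ?_⟩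
  · intro u v
    simp only [Sym2.eq_swap]
  · intro u v w hv hw h
    by_contra hne
    have h1 := Fin.succAbove_right_injective h
    have h2 := hlt' u v hv
    have h3 := hlt' u w hw
    simp only [Fin.ofNat, Fin.mk.injEq, Nat.mod_eq_of_lt h2, Nat.mod_eq_of_lt h3] at h1
    exact hC ⟨hv, hw, by simp [hne]; grind, u, by simp, by simp⟩ h1
  · intro u v _
    exact Fin.succAbove_ne _ _
  · intro h
    have := hCφ s(a, b) i (by simp [φ, h])
    simp [this]
  · intro h
    have := hCφ s(a', b') j (by
      by_cases h' : s(a', b') = s(a, b) ∧ G.Adj a b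
      · have hs : i = j := Fin.succAbove_right_injective ((hc h'.2 h).1 (by
          have := h'.1
          simp only [Sym2.eq_iff] at this
          unfold SameEdge
          grind))
        simp only [φ, if_pos h', hs]
      · simp only [φ, if_neg h']
        simp [h])
    simp [this]

section Constructions

variable {G : SimpleGraph V} {d : Fin 4}

/-- Start from two colorings avoiding `d` and matching edges of color `d`. Recoloring the matching
edges by `p` works if each edge of color `p v` at `v` can be given the color `d`. -/
theorem exists_isPrismColoring {f₀ f₁ : V → V → Fin 4} (h₀ : IsColoringAvoiding G d f₀)
    (h₁ : IsColoringAvoiding G d f₁) (p : V → Fin 4)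
    (hp₀ : ∀ u v, G.Adj u v → f₀ u v = p u → p v = p u)
    (hp₁ : ∀ u v, G.Adj u v → f₁ u v = p u → p v = p u) :
    ∃ c₀ c₁, IsPrismColoring G c₀ c₁ p ∧
      (∀ u v, G.Adj u v → c₀ u v = if f₀ u v = p u then d else f₀ u v) ∧
      (∀ u v, G.Adj u v → c₁ u v = if f₁ u v = p u then d else f₁ u v) ∧
      (f₀ = f₁ → c₀ = c₁) := by
  classical
  obtain ⟨s₀, q₀, a₀⟩ := h₀
  obtain ⟨s₁, q₁, a₁⟩ := h₁
  refine ⟨fun u v => if G.Adj u v ∧ f₀ u v = p u then d else f₀ u v,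
    fun u v => if G.Adj u v ∧ f₁ u v = p u then d else f₁ u v,
    ⟨?_, ?_, ?_, ?_, ?_, ?_⟩, ?_, ?_, ?_⟩
  · intro u v; have := G.adj_comm u v; grind
  · intro u v; have := G.adj_comm u v; grind
  · intro u v w; grind
  · intro u v w; grind
  · intro u v; grind
  · intro u v; grind
  · intro u v h; simp [h]
  · intro u v h; simp [h]
  · rintro rfl; rfl

/-- Recoloring a set `M` of independent edges with `d` in both copies. -/
theorem exists_isPrismColoring_of_matching {f : V → V → Fin 4} (hf : IsColoringAvoiding G d f)
    (M : V → V → Prop) (hsymm : ∀ u v, M u v → M v u) (hadj : ∀ u v, M u v → G.Adj u v)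
    (huniq : ∀ u v w, M u v → M u w → v = w) :
    ∃ c p, IsPrismColoring G c c p ∧ (∀ u v, M u v → c u v = d) ∧
      (∀ u v, G.Adj u v → ¬ M u v → c u v = f u v) ∧ ∀ v, (∀ u, ¬ M v u) → p v = d := by
  classical
  let p : V → Fin 4 := fun v => if h : ∃ u, M v u then f v h.choose else d
  have hpM : ∀ u v, M u v → p u = f u v := by
    intro u v h
    have h' : ∃ v, M u v := ⟨v, h⟩
    simp only [p, dif_pos h', huniq u _ v h'.choose_spec h]
  have hpN : ∀ u, (∀ v, ¬ M u v) → p u = d := by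
    intro u h
    simp [p, h]
  obtain ⟨s, q, a⟩ := hf
  have hiff : ∀ u v, G.Adj u v → f u v = p u → M u v := by
    intro u v huv h
    by_cases h' : ∃ w, M u w
    · obtain ⟨w, hw⟩ := h'
      have := hpM u w hw
      have := q u v w huv (hadj _ _ hw) (by rw [h, this])
      exact this ▸ hw
    · exact absurd (h.trans (hpN u (by simpa using h'))) (a u v huv)
  have hcl : ∀ u v, G.Adj u v → f u v = p u → p v = p u := by
    intro u v huv h
    rw [hpM v u (hsymm _ _ (hiff u v huv h)), ← h, s]
  obtain ⟨c, c', hc, hc₀, -, heq⟩ := exists_isPrismColoring ⟨s, q, a⟩ ⟨s, q, a⟩ p hcl hcl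
  obtain rfl := heq rfl
  refine ⟨c, p, hc, ?_, ?_, hpN⟩
  · intro u v h
    rw [hc₀ u v (hadj _ _ h), if_pos (hpM u v h).symm]
  · intro u v huv h
    rw [hc₀ u v huv, if_neg fun h' => h (hiff u v huv h')]

/-- Giving the color `c` to the matching edge at `w`. -/
theorem exists_isPrismColoring_of_vertex {f₀ f₁ : V → V → Fin 4} (h₀ : IsColoringAvoiding G d f₀)
    (h₁ : IsColoringAvoiding G d f₁) {w : V} {γ : Fin 4}
    (hw : ∀ y, G.Adj w y → (f₀ w y = γ ↔ f₁ w y = γ)) :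
    ∃ c₀ c₁ p, IsPrismColoring G c₀ c₁ p ∧ p w = γ ∧
      (∀ v, v ≠ w → (G.Adj w v → f₀ w v ≠ γ) → p v = d) ∧
      (∀ u v, G.Adj u v → (f₀ u v ≠ γ ∨ (u ≠ w ∧ v ≠ w)) → c₀ u v = f₀ u v) ∧
      (∀ u v, G.Adj u v → (f₁ u v ≠ γ ∨ (u ≠ w ∧ v ≠ w)) → c₁ u v = f₁ u v) ∧
      (f₀ = f₁ → c₀ = c₁) := by
  classical
  have s₀ := h₀.symm
  have q₀ := h₀.proper
  have a₀ := h₀.avoids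
  have s₁ := h₁.symm
  have q₁ := h₁.proper
  have a₁ := h₁.avoids
  have hcomm := G.adj_comm
  obtain ⟨c₀, c₁, hc, hc₀, hc₁, heq⟩ := exists_isPrismColoring h₀ h₁
    (fun v => if v = w ∨ (G.Adj w v ∧ f₀ w v = γ) then γ else d)
    (by intro u v huv; grind) (by intro u v huv; grind)
  refine ⟨c₀, c₁, _, hc, by simp, ?_, ?_, ?_, heq⟩
  · intro v; grind
  · intro u v huv; grind
  · intro u v huv; grind

/-- Giving distinct colors to two matching edges. -/
theorem exists_isPrismColoring_of_two_vertices {f : V → V → Fin 4}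
    (hf : IsColoringAvoiding G d f) {w₁ w₂ w₃ : V} {γ₂ γ₃ : Fin 4}
    (h₁₂ : w₁ ≠ w₂) (h₁₃ : w₁ ≠ w₃) (h₂₃ : w₂ ≠ w₃)
    (hf₁₂ : G.Adj w₁ w₂ → f w₁ w₂ ≠ γ₂) (hf₁₃ : G.Adj w₁ w₃ → f w₁ w₃ ≠ γ₃)
    (hf₂₃ : G.Adj w₂ w₃ → f w₂ w₃ ≠ γ₂ ∧ f w₂ w₃ ≠ γ₃)
    (hy : ∀ y, G.Adj w₂ y → G.Adj w₃ y → f w₂ y = γ₂ → f w₃ y ≠ γ₃) :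
    ∃ c p, IsPrismColoring G c c p ∧ p w₁ = d ∧ p w₂ = γ₂ ∧ p w₃ = γ₃ := by
  classical
  have s := hf.symm
  have q := hf.proper
  have a := hf.avoids
  have hcomm := G.adj_comm
  let p : V → Fin 4 := fun v => if v = w₂ ∨ (G.Adj w₂ v ∧ f w₂ v = γ₂) then γ₂ else
      if v = w₃ ∨ (G.Adj w₃ v ∧ f w₃ v = γ₃) then γ₃ else d
  have hcl : ∀ u v, G.Adj u v → f u v = p u → p v = p u := by
    intro u v huv
    simp only [p]
    grind
  obtain ⟨c, c', hc, -, -, heq⟩ := exists_isPrismColoring hf hf p hcl hcl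
  obtain rfl := heq rfl
  refine ⟨c, p, hc, ?_, ?_, ?_⟩ <;> simp only [p] <;> grind

end Constructions

section Extensions

variable {G : SimpleGraph V}

/-- A vertex of a triangle has no neighbor outside the triangle. -/
theorem TwoExtendable.eq_or_eq_of_triangle (hG : TwoExtendable G)
    {u v w a : V} (huv : G.Adj u v) (huw : G.Adj u w)
    (hvw : G.Adj v w) (hua : G.Adj u a) : a = v ∨ a = w := by
  by_contra! hne
  obtain ⟨f, ⟨s, q, av⟩, h₁, h₂⟩ := hG 0 u a 1 v w 2 (by decide) (by decide) (by
    intro _ _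
    have := huv.ne
    have := huw.ne
    unfold Compatible SameEdge DisjointEdge
    grind)
  have e₁ := h₁ hua
  have e₂ := h₂ hvw
  have key : ∀ x y : Fin 4, x ≠ 0 → y ≠ 0 → x ≠ 1 → y ≠ 1 → x ≠ 2 → y ≠ 2 → x = y := by decide
  have hcomm := G.adj_comm
  have := huv.ne
  have := huw.ne
  have := hvw.ne
  have := key (f u v) (f u w) (av _ _ huv) (av _ _ huw) (by grind) (by grind) (by grind) (by grind)
  grind

theorem TwoExtendable.horizontal_same_copy_of_ne (hG : TwoExtendable G)
    {a₁ b₁ a₂ b₂ a₃ b₃ : V} {α₁ α₂ α₃ : Fin 4}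
    (h₁ : G.Adj a₁ b₁) (h₂ : G.Adj a₂ b₂) (h₃ : G.Adj a₃ b₃)
    (h₂₃ : Compatible a₂ b₂ α₂ a₃ b₃ α₃) (hne₂ : α₁ ≠ α₂) (hne₃ : α₁ ≠ α₃)
    (h₁₂ : Compatible a₁ b₁ α₁ a₂ b₂ α₂) (h₁₃ : Compatible a₁ b₁ α₁ a₃ b₃ α₃) :
    ∃ c p, IsPrismColoring G c c p ∧ c a₁ b₁ = α₁ ∧ c a₂ b₂ = α₂ ∧ c a₃ b₃ = α₃ := by
  obtain ⟨f, hf, e₂, e₃⟩ := hG α₁ a₂ b₂ α₂ a₃ b₃ α₃ hne₂.symm hne₃.symm fun _ _ => h₂₃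
  have hcomm := G.adj_comm
  obtain ⟨c, p, hc, hM, hN, -⟩ := exists_isPrismColoring_of_matching hf
    (fun u v => SameEdge u v a₁ b₁) (by unfold SameEdge; grind) (by unfold SameEdge; grind)
    (by unfold SameEdge; grind [h₁.ne])
  unfold Compatible SameEdge at *
  exact ⟨c, p, hc, hM _ _ (by grind), by grind, by grind⟩

/-- Three precolored edges in the same copy of `G`. -/
theorem TwoExtendable.horizontal_same_copy (hG : TwoExtendable G)
    {a₁ b₁ a₂ b₂ a₃ b₃ : V} {α₁ α₂ α₃ : Fin 4}
    (h₁ : G.Adj a₁ b₁) (h₂ : G.Adj a₂ b₂) (h₃ : G.Adj a₃ b₃)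
    (h₁₂ : Compatible a₁ b₁ α₁ a₂ b₂ α₂) (h₁₃ : Compatible a₁ b₁ α₁ a₃ b₃ α₃)
    (h₂₃ : Compatible a₂ b₂ α₂ a₃ b₃ α₃) :
    ∃ c p, IsPrismColoring G c c p ∧ c a₁ b₁ = α₁ ∧ c a₂ b₂ = α₂ ∧ c a₃ b₃ = α₃ := by
  by_cases hne₁ : α₁ ≠ α₂ ∧ α₁ ≠ α₃
  · exact hG.horizontal_same_copy_of_ne h₁ h₂ h₃ h₂₃ hne₁.1 hne₁.2 h₁₂ h₁₃
  by_cases hne₂ : α₂ ≠ α₁ ∧ α₂ ≠ α₃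
  · obtain ⟨c, p, hc, e₂, e₁, e₃⟩ :=
      hG.horizontal_same_copy_of_ne h₂ h₁ h₃ h₁₃ hne₂.1 hne₂.2 h₁₂.symm h₂₃
    exact ⟨c, p, hc, e₁, e₂, e₃⟩
  by_cases hne₃ : α₃ ≠ α₁ ∧ α₃ ≠ α₂
  · obtain ⟨c, p, hc, e₃, e₁, e₂⟩ :=
      hG.horizontal_same_copy_of_ne h₃ h₁ h₂ h₁₂ hne₃.1 hne₃.2 h₁₃.symm h₂₃.symm
    exact ⟨c, p, hc, e₁, e₂, e₃⟩
  obtain rfl : α₁ = α₂ := by grind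
  obtain rfl : α₁ = α₃ := by grind
  obtain ⟨β, hβ, -⟩ := exists_fin_four_ne α₁ α₁ α₁
  obtain ⟨f, hf, -⟩ := hG α₁ a₁ b₁ β a₁ b₁ β hβ hβ fun _ _ => Compatible.refl _ _ _
  have hcomm := G.adj_comm
  obtain ⟨c, p, hc, hM, -, -⟩ := exists_isPrismColoring_of_matching hf
    (fun u v => SameEdge u v a₁ b₁ ∨ SameEdge u v a₂ b₂ ∨ SameEdge u v a₃ b₃)
    (by unfold SameEdge; grind) (by unfold SameEdge; grind) (by
      have := h₁.ne
      have := h₂.ne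
      have := h₃.ne
      unfold Compatible SameEdge DisjointEdge at *
      grind)
  unfold SameEdge at hM
  exact ⟨c, p, hc, hM _ _ (by grind), hM _ _ (by grind), hM _ _ (by grind)⟩

/-- Two precolored edges in the same copy of `G`, with matching edges of color `γ` wherever
possible. -/
theorem TwoExtendable.horizontal_pair (hG : TwoExtendable G)
    {a₁ b₁ a₂ b₂ : V} {α₁ α₂ : Fin 4} (γ : Fin 4)
    (h₁ : G.Adj a₁ b₁) (h₂ : G.Adj a₂ b₂) (h₁₂ : Compatible a₁ b₁ α₁ a₂ b₂ α₂) :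
    ∃ c p, IsPrismColoring G c c p ∧ c a₁ b₁ = α₁ ∧ c a₂ b₂ = α₂ ∧
      ∀ w, (α₁ = γ → w ≠ a₁ ∧ w ≠ b₁) → (α₂ = γ → w ≠ a₂ ∧ w ≠ b₂) → p w = γ := by
  obtain ⟨f, hf, e₁, e₂⟩ : ∃ f, IsColoringAvoiding G γ f ∧ (α₁ ≠ γ → f a₁ b₁ = α₁) ∧
      (α₂ ≠ γ → f a₂ b₂ = α₂) := by
    obtain ⟨β, hβ, -⟩ := exists_fin_four_ne γ γ γ
    by_cases hα₁ : α₁ = γ <;> by_cases hα₂ : α₂ = γ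
    · obtain ⟨f, hf, -⟩ := hG γ a₁ b₁ β a₁ b₁ β hβ hβ fun _ _ => Compatible.refl _ _ _
      exact ⟨f, hf, by grind, by grind⟩
    · obtain ⟨f, hf, e, -⟩ := hG γ a₂ b₂ α₂ a₂ b₂ α₂ hα₂ hα₂ fun _ _ => Compatible.refl _ _ _
      exact ⟨f, hf, by grind, by grind⟩
    · obtain ⟨f, hf, e, -⟩ := hG γ a₁ b₁ α₁ a₁ b₁ α₁ hα₁ hα₁ fun _ _ => Compatible.refl _ _ _
      exact ⟨f, hf, by grind, by grind⟩
    · obtain ⟨f, hf, e, e'⟩ := hG γ a₁ b₁ α₁ a₂ b₂ α₂ hα₁ hα₂ fun _ _ => h₁₂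
      exact ⟨f, hf, by grind, by grind⟩
  have hcomm := G.adj_comm
  obtain ⟨c, p, hc, hM, hN, hp⟩ := exists_isPrismColoring_of_matching hf
    (fun u v => (α₁ = γ ∧ SameEdge u v a₁ b₁) ∨ (α₂ = γ ∧ SameEdge u v a₂ b₂))
    (by unfold SameEdge; grind) (by unfold SameEdge; grind) (by
      have := h₁.ne
      have := h₂.ne
      unfold Compatible SameEdge DisjointEdge at *
      grind)
  unfold Compatible SameEdge at *
  exact ⟨c, p, hc, by grind, by grind, by grind⟩

/-- Two precolored edges in one copy of `G` and a third one in the other copy. -/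
theorem TwoExtendable.horizontal_two_copies (hG : TwoExtendable G)
    {a₁ b₁ a₂ b₂ a₃ b₃ : V} {α₁ α₂ α₃ : Fin 4}
    (h₁ : G.Adj a₁ b₁) (h₂ : G.Adj a₂ b₂) (h₃ : G.Adj a₃ b₃)
    (h₁₂ : Compatible a₁ b₁ α₁ a₂ b₂ α₂) :
    ∃ c₀ c₁ p, IsPrismColoring G c₀ c₁ p ∧ c₀ a₁ b₁ = α₁ ∧ c₀ a₂ b₂ = α₂ ∧ c₁ a₃ b₃ = α₃ := by
  obtain ⟨d, hd₁, hd₂, hd₃⟩ := exists_fin_four_ne α₁ α₂ α₃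
  obtain ⟨f₀, hf₀, e₁, e₂⟩ := hG d a₁ b₁ α₁ a₂ b₂ α₂ hd₁.symm hd₂.symm fun _ _ => h₁₂
  obtain ⟨f₁, hf₁, e₃, -⟩ :=
    hG d a₃ b₃ α₃ a₃ b₃ α₃ hd₃.symm hd₃.symm fun _ _ => Compatible.refl _ _ _
  obtain ⟨c₀, c₁, hc, hc₀, hc₁, -⟩ :=
    exists_isPrismColoring hf₀ hf₁ (fun _ => d) (by grind) (by grind)
  exact ⟨c₀, c₁, _, hc, by grind, by grind, by grind⟩

/-- Adjacent edges in different copies and a matching edge, all of the same color. -/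
theorem TwoExtendable.adjacent_two_copies (hG : TwoExtendable G)
    {u v x w : V} (γ : Fin 4) (huv : G.Adj u v)
    (hvx : G.Adj v x) (hux : u ≠ x) (hwu : w ≠ u) (hwv : w ≠ v) (hwx : w ≠ x) :
    ∃ c₀ c₁ p, IsPrismColoring G c₀ c₁ p ∧ c₀ u v = γ ∧ c₁ v x = γ ∧ p w = γ := by
  obtain ⟨d, hd, -⟩ := exists_fin_four_ne γ γ γ
  obtain ⟨β, hβ, hβd, -⟩ := exists_fin_four_ne γ d d
  have hcomm := G.adj_comm
  have := huv.ne
  have := hvx.ne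
  by_cases hy : ∃ y, G.Adj w y ∧ y ≠ u ∧ y ≠ v ∧ y ≠ x
  · obtain ⟨y, hwy, hyu, hyv, hyx⟩ := hy
    obtain ⟨f₀, hf₀, e₁, e₂⟩ := hG d u v γ w y γ hd.symm hd.symm (by
      unfold Compatible SameEdge DisjointEdge; grind)
    obtain ⟨f₁, hf₁, e₃, e₄⟩ := hG d v x γ w y γ hd.symm hd.symm (by
      unfold Compatible SameEdge DisjointEdge; grind)
    have q₀ := hf₀.proper
    have q₁ := hf₁.proper
    obtain ⟨c₀, c₁, p, hc, hp, -, hc₀, hc₁, -⟩ :=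
      exists_isPrismColoring_of_vertex hf₀ hf₁ (w := w) (γ := γ) (by grind)
    exact ⟨c₀, c₁, p, hc, by grind, by grind, hp⟩
  · obtain ⟨f₀, hf₀, e₁, e₂⟩ := hG d u v γ w x β hd.symm hβd (by
      unfold Compatible SameEdge DisjointEdge; grind)
    obtain ⟨f₁, hf₁, e₃, e₄⟩ := hG d v x γ w u β hd.symm hβd (by
      unfold Compatible SameEdge DisjointEdge; grind)
    have q₀ := hf₀.proper
    have q₁ := hf₁.proper
    have s₀ := hf₀.symm
    have s₁ := hf₁.symm
    have n₀ : ∀ y, G.Adj w y → f₀ w y ≠ γ := by grind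
    have n₁ : ∀ y, G.Adj w y → f₁ w y ≠ γ := by grind
    obtain ⟨c₀, c₁, p, hc, hp, -, hc₀, hc₁, -⟩ :=
      exists_isPrismColoring_of_vertex hf₀ hf₁ (w := w) (γ := γ) (by grind)
    exact ⟨c₀, c₁, p, hc, by grind, by grind, hp⟩

theorem TwoExtendable.same_edge_of_not_adj (hG : TwoExtendable G)
    {u v w : V} {γ α : Fin 4} (huv : G.Adj u v)
    (hwu : w ≠ u) (hwv : w ≠ v) (hN : ∀ y, G.Adj w y → y = u) :
    ∃ c₀ c₁ p, IsPrismColoring G c₀ c₁ p ∧ c₀ u v = γ ∧ c₁ u v = α ∧ p w = γ := by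
  obtain ⟨d, hd, hdα, -⟩ := exists_fin_four_ne γ α α
  obtain ⟨β, hβ, hβd, hβα⟩ := exists_fin_four_ne γ d α
  have hcomm := G.adj_comm
  obtain ⟨f₀, hf₀, e₁, -⟩ := hG d u v γ u v γ hd.symm hd.symm fun _ _ => Compatible.refl _ _ _
  obtain ⟨f₁, hf₁, e₃, e₄⟩ := hG d u v α w u β hdα.symm hβd (by
    unfold Compatible SameEdge DisjointEdge; grind)
  have q₀ := hf₀.proper
  have s₀ := hf₀.symm
  have n₀ : ∀ y, G.Adj w y → f₀ w y ≠ γ := by grind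
  have n₁ : ∀ y, G.Adj w y → f₁ w y ≠ γ := by grind
  obtain ⟨c₀, c₁, p, hc, hp, -, hc₀, hc₁, -⟩ :=
    exists_isPrismColoring_of_vertex hf₀ hf₁ (w := w) (γ := γ) (by grind)
  exact ⟨c₀, c₁, p, hc, by grind, by grind, hp⟩

/-- An edge precolored differently in the two copies, and a matching edge. -/
theorem TwoExtendable.same_edge_two_copies (hG : TwoExtendable G)
    {u v w : V} {γ α : Fin 4} (huv : G.Adj u v)
    (hα : α ≠ γ) (hwu : w ≠ u) (hwv : w ≠ v) :
    ∃ c₀ c₁ p, IsPrismColoring G c₀ c₁ p ∧ c₀ u v = γ ∧ c₁ u v = α ∧ p w = γ := by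
  classical
  obtain ⟨d, hd, hdα, -⟩ := exists_fin_four_ne γ α α
  have hcomm := G.adj_comm
  have := huv.ne
  by_cases hy : ∃ y, G.Adj w y ∧ y ≠ u ∧ y ≠ v
  · obtain ⟨y, hwy, hyu, hyv⟩ := hy
    obtain ⟨f₀, hf₀, e₁, e₂⟩ := hG d u v γ w y γ hd.symm hd.symm (by
      unfold Compatible SameEdge DisjointEdge; grind)
    obtain ⟨f₁, hf₁, e₃, e₄⟩ := hG d u v α w y γ hdα.symm hd.symm (by
      unfold Compatible SameEdge DisjointEdge; grind)
    have q₀ := hf₀.proper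
    have q₁ := hf₁.proper
    obtain ⟨c₀, c₁, p, hc, hp, -, hc₀, hc₁, -⟩ :=
      exists_isPrismColoring_of_vertex hf₀ hf₁ (w := w) (γ := γ) (by grind)
    exact ⟨c₀, c₁, p, hc, by grind, by grind, hp⟩
  push Not at hy
  by_cases hwv' : G.Adj w v
  swap
  · exact hG.same_edge_of_not_adj huv hwu hwv (by grind)
  by_cases hwu' : G.Adj w u
  swap
  · obtain ⟨c₀, c₁, p, hc, e₀, e₁, hp⟩ :=
      hG.same_edge_of_not_adj huv.symm hwv hwu (by grind)
    exact ⟨c₀, c₁, p, hc, hc.symm₀ u v ▸ e₀, hc.symm₁ u v ▸ e₁, hp⟩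
  have hu : ∀ y, G.Adj u y → y = v ∨ y = w :=
    fun y h => hG.eq_or_eq_of_triangle huv hwu'.symm hwv'.symm h
  have hv : ∀ y, G.Adj v y → y = u ∨ y = w :=
    fun y h => hG.eq_or_eq_of_triangle huv.symm hwv'.symm hwu'.symm h
  obtain ⟨f, ⟨s, q, a⟩, e, -⟩ := hG γ u v α u v α hα hα fun _ _ => Compatible.refl _ _ _
  have a₁ := a u v huv
  have a₂ := a u w hwu'.symm
  have a₃ := a v w hwv'.symm
  have e₁ : f u v ≠ f u w := by grind
  have e₂ : f u v ≠ f v w := by grind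
  have e₃ : f u w ≠ f v w := by grind
  refine ⟨fun x y => if SameEdge x y u v then γ else f x y, f,
    fun x => if x = u then f v w else if x = v then f u w else γ,
    ⟨?_, s, ?_, q, ?_, ?_⟩, ?_, by grind, ?_⟩
  · unfold SameEdge; grind
  · unfold SameEdge; grind
  · unfold SameEdge; grind
  · grind
  · unfold SameEdge; grind
  · grind

/-- One precolored edge in each copy of `G` and one precolored matching edge. -/
theorem TwoExtendable.horizontal_horizontal_vertical (hG : TwoExtendable G)
    {a₁ b₁ a₂ b₂ w : V} {α₁ α₂ γ : Fin 4}
    (h₁ : G.Adj a₁ b₁) (h₂ : G.Adj a₂ b₂) (hw₁ : α₁ = γ → w ≠ a₁ ∧ w ≠ b₁)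
    (hw₂ : α₂ = γ → w ≠ a₂ ∧ w ≠ b₂) :
    ∃ c₀ c₁ p, IsPrismColoring G c₀ c₁ p ∧ c₀ a₁ b₁ = α₁ ∧ c₁ a₂ b₂ = α₂ ∧ p w = γ := by
  by_cases h₁₂ : Compatible a₁ b₁ α₁ a₂ b₂ α₂
  · obtain ⟨c, p, hc, e₁, e₂, hp⟩ := hG.horizontal_pair γ h₁ h₂ h₁₂
    exact ⟨c, c, p, hc, e₁, e₂, hp w hw₁ hw₂⟩
  by_cases hne : α₁ ≠ γ ∧ α₂ ≠ γ
  · obtain ⟨f₀, hf₀, e₁, -⟩ :=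
      hG γ a₁ b₁ α₁ a₁ b₁ α₁ hne.1 hne.1 fun _ _ => Compatible.refl _ _ _
    obtain ⟨f₁, hf₁, e₂, -⟩ :=
      hG γ a₂ b₂ α₂ a₂ b₂ α₂ hne.2 hne.2 fun _ _ => Compatible.refl _ _ _
    have av₀ := hf₀.avoids
    have av₁ := hf₁.avoids
    obtain ⟨c₀, c₁, hc, hc₀, hc₁, -⟩ :=
      exists_isPrismColoring hf₀ hf₁ (fun _ => γ) (by grind) (by grind)
    exact ⟨c₀, c₁, _, hc, by grind, by grind, rfl⟩
  by_cases hα : α₁ = α₂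
  · obtain rfl := hα
    obtain rfl : α₁ = γ := by grind
    obtain ⟨hwa₁, hwb₁⟩ := hw₁ rfl
    obtain ⟨hwa₂, hwb₂⟩ := hw₂ rfl
    have := h₁.ne
    have := h₂.ne
    have hcase : (b₁ = a₂ ∧ a₁ ≠ b₂) ∨ (b₁ = b₂ ∧ a₁ ≠ a₂) ∨ (a₁ = a₂ ∧ b₁ ≠ b₂) ∨
        (a₁ = b₂ ∧ b₁ ≠ a₂) := by
      unfold Compatible SameEdge DisjointEdge at h₁₂
      grind
    rcases hcase with ⟨rfl, hne⟩ | ⟨rfl, hne⟩ | ⟨rfl, hne⟩ | ⟨rfl, hne⟩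
    · exact hG.adjacent_two_copies α₁ h₁ h₂ hne hwa₁ hwb₁ hwb₂
    · obtain ⟨c₀, c₁, p, hc, e₀, e₁, hp⟩ :=
        hG.adjacent_two_copies α₁ h₁ h₂.symm hne hwa₁ hwb₁ hwa₂
      exact ⟨c₀, c₁, p, hc, e₀, hc.symm₁ _ _ ▸ e₁, hp⟩
    · obtain ⟨c₀, c₁, p, hc, e₀, e₁, hp⟩ :=
        hG.adjacent_two_copies α₁ h₁.symm h₂ hne hwb₁ hwa₁ hwb₂
      exact ⟨c₀, c₁, p, hc, hc.symm₀ _ _ ▸ e₀, e₁, hp⟩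
    · obtain ⟨c₀, c₁, p, hc, e₀, e₁, hp⟩ :=
        hG.adjacent_two_copies α₁ h₁.symm h₂.symm hne hwb₁ hwa₁ hwa₂
      exact ⟨c₀, c₁, p, hc, hc.symm₀ _ _ ▸ e₀, hc.symm₁ _ _ ▸ e₁, hp⟩
  · have hsame : SameEdge a₁ b₁ a₂ b₂ := by
      by_contra h
      exact h₁₂ ⟨fun h' => absurd h' h, fun h' => absurd h' hα⟩
    have main : ∃ c₀ c₁ p, IsPrismColoring G c₀ c₁ p ∧ c₀ a₁ b₁ = α₁ ∧ c₁ a₁ b₁ = α₂ ∧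
        p w = γ := by
      by_cases h : α₁ = γ
      · subst h
        exact hG.same_edge_two_copies h₁ (Ne.symm hα) (hw₁ rfl).1 (hw₁ rfl).2
      · obtain rfl : α₂ = γ := by grind
        obtain ⟨c₀, c₁, p, hc, e₀, e₁, hp⟩ := hG.same_edge_two_copies (w := w) h₁ hα
          (by unfold SameEdge at hsame; grind) (by unfold SameEdge at hsame; grind)
        exact ⟨c₁, c₀, p, hc.swap, e₁, e₀, hp⟩
    obtain ⟨c₀, c₁, p, hc, e₀, e₁, hp⟩ := main
    rcases hsame with ⟨rfl, rfl⟩ | ⟨rfl, rfl⟩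
    · exact ⟨c₀, c₁, p, hc, e₀, e₁, hp⟩
    · exact ⟨c₀, c₁, p, hc, e₀, hc.symm₁ _ _ ▸ e₁, hp⟩

theorem TwoExtendable.horizontal_vertical_vertical_of_ne (hG : TwoExtendable G)
    {a b w₁ w₂ : V} {α γ₁ γ₂ : Fin 4}
    (h : G.Adj a b) (hw₁ : α = γ₁ → w₁ ≠ a ∧ w₁ ≠ b) (hα : α ≠ γ₂)
    (hw : w₁ ≠ w₂) (hγ : γ₁ ≠ γ₂) :
    ∃ c p, IsPrismColoring G c c p ∧ c a b = α ∧ p w₁ = γ₁ ∧ p w₂ = γ₂ := by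
  have hcomm := G.adj_comm
  by_cases hy : ∃ y, G.Adj w₁ y ∧ y ≠ w₂ ∧ Compatible a b α w₁ y γ₁
  · obtain ⟨y, hwy, hyw, hcomp⟩ := hy
    obtain ⟨f, hf, e₁, e₂⟩ := hG γ₂ a b α w₁ y γ₁ hα hγ fun _ _ => hcomp
    have q := hf.proper
    obtain ⟨c, c', p, hc, hp, hp', hc₀, -, heq⟩ :=
      exists_isPrismColoring_of_vertex hf hf (w := w₁) (γ := γ₁) (by grind)
    obtain rfl := heq rfl
    exact ⟨c, p, hc, by grind, hp, by grind⟩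
  · push Not at hy
    obtain ⟨β, hβ₁, hβ₂, hβα⟩ := exists_fin_four_ne γ₁ γ₂ α
    obtain ⟨f, hf, e₁, e₂⟩ : ∃ f, IsColoringAvoiding G γ₂ f ∧ f a b = α ∧
        (G.Adj w₁ w₂ → ¬ SameEdge a b w₁ w₂ → f w₁ w₂ = β) := by
      by_cases hs : SameEdge a b w₁ w₂
      · obtain ⟨f, hf, e₁, -⟩ := hG γ₂ a b α a b α hα hα fun _ _ => Compatible.refl _ _ _
        exact ⟨f, hf, e₁ h, by grind⟩
      · obtain ⟨f, hf, e₁, e₂⟩ := hG γ₂ a b α w₁ w₂ β hα hβ₂ (by unfold Compatible; grind)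
        exact ⟨f, hf, e₁ h, by grind⟩
    have q := hf.proper
    have s := hf.symm
    have n : ∀ y, G.Adj w₁ y → f w₁ y ≠ γ₁ := by
      intro y hwy hfy
      have hsame : SameEdge a b w₁ y → α = γ₁ := by
        rintro (⟨rfl, rfl⟩ | ⟨rfl, rfl⟩)
        · exact e₁.symm.trans hfy
        · exact e₁.symm.trans ((s _ _).trans hfy)
      have hnot : α = γ₁ → ¬ SameEdge a b w₁ y := by
        rintro hα' (⟨rfl, -⟩ | ⟨-, rfl⟩)
        · exact (hw₁ hα').1 rfl
        · exact (hw₁ hα').2 rfl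
      have hs : ¬ SameEdge a b w₁ y := fun hs => hnot (hsame hs) hs
      by_cases hyw : y = w₂
      · subst hyw
        exact hβ₁ ((e₂ hwy hs).symm.trans hfy)
      have hα' : α = γ₁ := by
        by_contra hα'
        exact hy y hwy hyw ⟨fun h => absurd h hs, fun h => absurd h hα'⟩
      obtain ⟨ha, hb⟩ := hw₁ hα'
      have hfa : f y w₁ = α := (s _ _).trans (hfy.trans hα'.symm)
      refine hy y hwy hyw ⟨fun h => absurd h hs, fun _ => Or.inr ?_⟩
      have hya : y ≠ a := by
        rintro rfl
        exact hb (q _ _ _ hwy.symm h (hfa.trans e₁.symm))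
      have hyb : y ≠ b := by
        rintro rfl
        exact ha (q _ _ _ hwy.symm h.symm (hfa.trans (e₁.symm.trans (s _ _))))
      unfold DisjointEdge
      grind
    obtain ⟨c, c', p, hc, hp, hp', hc₀, -, heq⟩ :=
      exists_isPrismColoring_of_vertex hf hf (w := w₁) (γ := γ₁) (by grind)
    obtain rfl := heq rfl
    exact ⟨c, p, hc, by grind, hp, by grind⟩

/-- One precolored edge in a copy of `G` and two precolored matching edges. -/
theorem TwoExtendable.horizontal_vertical_vertical (hG : TwoExtendable G)
    {a b w₁ w₂ : V} {α γ₁ γ₂ : Fin 4}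
    (h : G.Adj a b) (hw₁ : α = γ₁ → w₁ ≠ a ∧ w₁ ≠ b) (hw₂ : α = γ₂ → w₂ ≠ a ∧ w₂ ≠ b)
    (hw : w₁ = w₂ → γ₁ = γ₂) :
    ∃ c p, IsPrismColoring G c c p ∧ c a b = α ∧ p w₁ = γ₁ ∧ p w₂ = γ₂ := by
  by_cases hγ : γ₁ = γ₂
  · subst hγ
    obtain ⟨c, p, hc, e, -, hp⟩ := hG.horizontal_pair γ₁ h h (Compatible.refl a b α)
    exact ⟨c, p, hc, e, hp _ hw₁ hw₁, hp _ hw₂ hw₂⟩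
  by_cases hα : α = γ₂
  · obtain ⟨c, p, hc, e, e₂, e₁⟩ := hG.horizontal_vertical_vertical_of_ne (w₁ := w₂) (w₂ := w₁)
      (γ₁ := γ₂) (γ₂ := γ₁) h hw₂ (by grind) (by grind) (by grind)
    exact ⟨c, p, hc, e, e₁, e₂⟩
  · exact hG.horizontal_vertical_vertical_of_ne h hw₁ hα (by grind) hγ

theorem TwoExtendable.vertical_of_pair_eq (hG : TwoExtendable G)
    {w₁ w₂ w₃ : V} {γ₁ γ : Fin 4} (h₁₂ : w₁ ≠ w₂) (h₁₃ : w₁ ≠ w₃) :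
    ∃ c p, IsPrismColoring G c c p ∧ p w₁ = γ₁ ∧ p w₂ = γ ∧ p w₃ = γ := by
  obtain ⟨β, hβ₁, hβ, -⟩ := exists_fin_four_ne γ₁ γ γ
  obtain ⟨β', hβ₁', hβ', hββ⟩ := exists_fin_four_ne γ₁ γ β
  have hcomm := G.adj_comm
  obtain ⟨f, hf, n₂, n₃⟩ : ∃ f, IsColoringAvoiding G γ f ∧ (G.Adj w₁ w₂ → f w₁ w₂ ≠ γ₁) ∧
      (G.Adj w₁ w₃ → f w₁ w₃ ≠ γ₁) := by
    by_cases h₂₃ : w₂ = w₃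
    · obtain ⟨f, hf, e, -⟩ := hG γ w₁ w₂ β w₁ w₂ β hβ hβ fun _ _ => Compatible.refl _ _ _
      exact ⟨f, hf, by grind, by grind⟩
    · obtain ⟨f, hf, e, e'⟩ := hG γ w₁ w₂ β w₁ w₃ β' hβ hβ' (by
        unfold Compatible SameEdge; grind)
      exact ⟨f, hf, by grind, by grind⟩
  obtain ⟨c, c', p, hc, hp, hp', -, -, heq⟩ :=
    exists_isPrismColoring_of_vertex hf hf (w := w₁) (γ := γ₁) (by grind)
  obtain rfl := heq rfl
  exact ⟨c, p, hc, hp, by grind, by grind⟩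

theorem TwoExtendable.vertical_of_path (hG : TwoExtendable G)
    {w₁ w₂ w₃ : V} {γ₁ γ₂ γ₃ : Fin 4} (h₁₂ : G.Adj w₁ w₂)
    (h₂₃ : G.Adj w₂ w₃) (h₁₃ : w₁ ≠ w₃) (hγ₁₃ : γ₁ ≠ γ₃) (hγ₂₃ : γ₂ ≠ γ₃) :
    ∃ c p, IsPrismColoring G c c p ∧ p w₁ = γ₁ ∧ p w₂ = γ₂ ∧ p w₃ = γ₃ := by
  obtain ⟨β, hβ₁, hβ₂, hβ₃⟩ := exists_fin_four_ne γ₁ γ₂ γ₃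
  have hcomm := G.adj_comm
  have := h₁₂.ne
  have := h₂₃.ne
  obtain ⟨f, hf, e₁, e₂⟩ := hG γ₁ w₂ w₃ β w₁ w₂ γ₃ hβ₁ hγ₁₃.symm (by
    unfold Compatible SameEdge; grind)
  have q := hf.proper
  have s := hf.symm
  refine exists_isPrismColoring_of_two_vertices hf h₁₂.ne h₁₃ h₂₃.ne (by grind) (by grind)
    (by grind) ?_
  intro y hy₂ hy₃
  have := hG.eq_or_eq_of_triangle h₂₃ hy₂ hy₃ h₁₂.symm
  grind

theorem TwoExtendable.vertical_of_adj (hG : TwoExtendable G)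
    {w₁ w₂ w₃ : V} {γ₁ γ₂ γ₃ : Fin 4} (h₁₂ : w₁ ≠ w₂)
    (h₁₃ : w₁ ≠ w₃) (h₂₃ : G.Adj w₂ w₃) (hγ₁₂ : γ₁ ≠ γ₂) (hγ₁₃ : γ₁ ≠ γ₃) (hγ₂₃ : γ₂ ≠ γ₃) :
    ∃ c p, IsPrismColoring G c c p ∧ p w₁ = γ₁ ∧ p w₂ = γ₂ ∧ p w₃ = γ₃ := by
  by_cases hw₂ : G.Adj w₁ w₂
  · exact hG.vertical_of_path hw₂ h₂₃ h₁₃ hγ₁₃ hγ₂₃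
  by_cases hw₃ : G.Adj w₁ w₃
  · obtain ⟨c, p, hc, e₁, e₃, e₂⟩ :=
      hG.vertical_of_path hw₃ h₂₃.symm h₁₂ hγ₁₂ hγ₂₃.symm
    exact ⟨c, p, hc, e₁, e₂, e₃⟩
  obtain ⟨β, hβ₁, hβ₂, hβ₃⟩ := exists_fin_four_ne γ₁ γ₂ γ₃
  have hcomm := G.adj_comm
  have := h₂₃.ne
  by_cases hy : ∃ y, G.Adj w₂ y ∧ G.Adj w₃ y
  · obtain ⟨y, hy₂, hy₃⟩ := hy
    have := hy₃.ne
    obtain ⟨f, hf, e₁, e₂⟩ := hG γ₁ w₂ w₃ β w₂ y γ₃ hβ₁ hγ₁₃.symm (by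
      unfold Compatible SameEdge; grind)
    refine exists_isPrismColoring_of_two_vertices hf h₁₂ h₁₃ h₂₃.ne (by grind) (by grind)
      (by grind) ?_
    intro z hz₂ hz₃
    have := hG.eq_or_eq_of_triangle h₂₃ hy₂ hy₃ hz₂
    have := hz₃.ne
    grind
  · obtain ⟨f, hf, e₁, -⟩ :=
      hG γ₁ w₂ w₃ β w₂ w₃ β hβ₁ hβ₁ fun _ _ => Compatible.refl _ _ _
    exact exists_isPrismColoring_of_two_vertices hf h₁₂ h₁₃ h₂₃.ne (by grind) (by grind)
      (by grind) (by grind)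

/-- Three precolored matching edges. -/
theorem TwoExtendable.vertical (hG : TwoExtendable G)
    {w₁ w₂ w₃ : V} {γ₁ γ₂ γ₃ : Fin 4} (h₁₂ : w₁ = w₂ → γ₁ = γ₂)
    (h₁₃ : w₁ = w₃ → γ₁ = γ₃) (h₂₃ : w₂ = w₃ → γ₂ = γ₃) :
    ∃ c p, IsPrismColoring G c c p ∧ p w₁ = γ₁ ∧ p w₂ = γ₂ ∧ p w₃ = γ₃ := by
  by_cases hγ₁₂ : γ₁ = γ₂ <;> by_cases hγ₁₃ : γ₁ = γ₃
  · subst hγ₁₂ hγ₁₃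
    obtain ⟨β, hβ, -⟩ := exists_fin_four_ne γ₁ γ₁ γ₁
    obtain ⟨f, hf, -⟩ := hG γ₁ w₁ w₁ β w₁ w₁ β hβ hβ fun _ _ => Compatible.refl _ _ _
    have a := hf.avoids
    obtain ⟨c, c', hc, -, -, heq⟩ :=
      exists_isPrismColoring hf hf (fun _ => γ₁) (by grind) (by grind)
    obtain rfl := heq rfl
    exact ⟨c, _, hc, rfl, rfl, rfl⟩
  · subst hγ₁₂
    obtain ⟨c, p, hc, e₃, e₁, e₂⟩ := hG.vertical_of_pair_eq (w₁ := w₃) (w₂ := w₁) (w₃ := w₂)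
      (γ₁ := γ₃) (γ := γ₁) (by grind) (by grind)
    exact ⟨c, p, hc, e₁, e₂, e₃⟩
  · subst hγ₁₃
    obtain ⟨c, p, hc, e₂, e₁, e₃⟩ := hG.vertical_of_pair_eq (w₁ := w₂) (w₂ := w₁) (w₃ := w₃)
      (γ₁ := γ₂) (γ := γ₁) (by grind) (by grind)
    exact ⟨c, p, hc, e₁, e₂, e₃⟩
  by_cases hγ₂₃ : γ₂ = γ₃
  · subst hγ₂₃
    exact hG.vertical_of_pair_eq (by grind) (by grind)
  have n₁₂ : w₁ ≠ w₂ := fun h => hγ₁₂ (h₁₂ h)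
  have n₁₃ : w₁ ≠ w₃ := fun h => hγ₁₃ (h₁₃ h)
  have n₂₃ : w₂ ≠ w₃ := fun h => hγ₂₃ (h₂₃ h)
  by_cases a₂₃ : G.Adj w₂ w₃
  · exact hG.vertical_of_adj n₁₂ n₁₃ a₂₃ hγ₁₂ hγ₁₃ hγ₂₃
  by_cases a₁₃ : G.Adj w₁ w₃
  · obtain ⟨c, p, hc, e₂, e₁, e₃⟩ :=
      hG.vertical_of_adj n₁₂.symm n₂₃ a₁₃ (Ne.symm hγ₁₂) hγ₂₃ hγ₁₃
    exact ⟨c, p, hc, e₁, e₂, e₃⟩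
  by_cases a₁₂ : G.Adj w₁ w₂
  · obtain ⟨c, p, hc, e₃, e₁, e₂⟩ :=
      hG.vertical_of_adj n₁₃.symm n₂₃.symm a₁₂ (Ne.symm hγ₁₃) (Ne.symm hγ₂₃) hγ₁₂
    exact ⟨c, p, hc, e₁, e₂, e₃⟩
  obtain ⟨β, hβ₁, hβ₂, hβ₃⟩ := exists_fin_four_ne γ₁ γ₂ γ₃
  obtain ⟨f, hf, hy⟩ : ∃ f, IsColoringAvoiding G γ₁ f ∧
      ∀ y, G.Adj w₂ y → G.Adj w₃ y → f w₂ y = γ₂ → f w₃ y ≠ γ₃ := by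
    by_cases hy : ∃ y, G.Adj w₂ y ∧ G.Adj w₃ y
    · obtain ⟨y, hy₂, hy₃⟩ := hy
      obtain ⟨f, hf, e₁, e₂⟩ := hG γ₁ w₂ y γ₂ w₃ y β (Ne.symm hγ₁₂) hβ₁ (by
        have := hy₂.ne
        unfold Compatible SameEdge
        grind)
      have q := hf.proper
      exact ⟨f, hf, by grind⟩
    · obtain ⟨f, hf, -⟩ := hG γ₁ w₁ w₁ β w₁ w₁ β hβ₁ hβ₁ fun _ _ => Compatible.refl _ _ _
      exact ⟨f, hf, by grind⟩
  exact exists_isPrismColoring_of_two_vertices hf n₁₂ n₁₃ n₂₃ (by grind) (by grind)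
    (by grind) hy

end Extensions

section Prism

variable {G : SimpleGraph V}

theorem IsPrismColoring.exists_edgeColoring {c₀ c₁ : V → V → Fin 4} {p : V → Fin 4}
    (h : IsPrismColoring G c₀ c₁ p) :
    ∃ C : Sym2 (V × Fin 2) → ℕ, IsProperEdgeColoring (G.boxProd (⊤ : SimpleGraph (Fin 2))) C ∧
      ColorsBelow (G.boxProd (⊤ : SimpleGraph (Fin 2))) C 4 ∧
      (∀ a b, C s((a, 0), (b, 0)) = c₀ a b) ∧ (∀ a b, C s((a, 1), (b, 1)) = c₁ a b) ∧
      ∀ w, C s((w, 0), (w, 1)) = p w := by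
  classical
  obtain ⟨s₀, s₁, q₀, q₁, n₀, n₁⟩ := h
  let g : V × Fin 2 → V × Fin 2 → Fin 4 := fun x y =>
    if x.2 = y.2 then (if x.2 = 0 then c₀ x.1 y.1 else c₁ x.1 y.1)
    else if x.1 = y.1 then p x.1 else 0
  have hg : ∀ x y, g x y = g y x := by
    intro x y
    simp only [g]
    grind
  refine ⟨fun e => (Sym2.lift ⟨g, hg⟩ e).val, ?_, ?_, ?_, ?_, ?_⟩
  · rintro e f ⟨he, hf, hne, v, hve, hvf⟩ heq
    obtain ⟨⟨a, i⟩, rfl⟩ := hve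
    obtain ⟨⟨b, j⟩, rfl⟩ := hvf
    obtain ⟨v, k⟩ := v
    simp only [Sym2.lift_mk, SimpleGraph.mem_edgeSet, SimpleGraph.boxProd_adj,
      SimpleGraph.top_adj, g] at he hf heq
    have hab : ¬ (a = b ∧ i = j) := by
      rintro ⟨rfl, rfl⟩
      exact hne rfl
    grind
  · intro e _
    exact Fin.isLt _
  all_goals simp [g]

/-- `e` lies in the first copy of `G`, lies in the second one, or joins the copies, according to
`k`. -/
def HasKind (G : SimpleGraph V) (k : ℕ) (e : Sym2 (V × Fin 2)) : Prop :=
  (k = 0 ∧ ∃ a b, G.Adj a b ∧ e = s((a, 0), (b, 0))) ∨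
  (k = 1 ∧ ∃ a b, G.Adj a b ∧ e = s((a, 1), (b, 1))) ∨
  (k = 2 ∧ ∃ w, e = s((w, 0), (w, 1)))

theorem exists_hasKind {e : Sym2 (V × Fin 2)}
    (he : e ∈ (G.boxProd (⊤ : SimpleGraph (Fin 2))).edgeSet) : ∃ k, HasKind G k e := by
  induction e with | _ x y
  obtain ⟨a, i⟩ := x
  obtain ⟨b, j⟩ := y
  simp only [SimpleGraph.mem_edgeSet, SimpleGraph.boxProd_adj, SimpleGraph.top_adj] at he
  rcases he with ⟨hab, rfl⟩ | ⟨hij, rfl⟩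
  · rcases Fin.exists_fin_two.1 ⟨i, rfl⟩ with rfl | rfl
    · exact ⟨0, .inl ⟨rfl, a, b, hab, rfl⟩⟩
    · exact ⟨1, .inr (.inl ⟨rfl, a, b, hab, rfl⟩)⟩
  · refine ⟨2, .inr (.inr ⟨rfl, a, ?_⟩)⟩
    fin_cases i <;> fin_cases j <;> simp_all

/-- Coloring the edges `e` and `e'` of `G □ K₂` with `α` and `α'` creates no conflict. -/
def PrismCompatible (G : SimpleGraph V) (e : Sym2 (V × Fin 2)) (α : Fin 4)
    (e' : Sym2 (V × Fin 2)) (α' : Fin 4) : Prop :=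
  (e = e' → α = α') ∧ (EdgeAdj (G.boxProd (⊤ : SimpleGraph (Fin 2))) e e' → α ≠ α')

theorem PrismCompatible.symm {e e' : Sym2 (V × Fin 2)} {α α' : Fin 4}
    (h : PrismCompatible G e α e' α') : PrismCompatible G e' α' e α :=
  ⟨fun h' => (h.1 h'.symm).symm,
    fun ⟨he, he', hne, v, hv, hv'⟩ => (h.2 ⟨he', he, hne.symm, v, hv', hv⟩).symm⟩

theorem PrismCompatible.compatible {i : Fin 2} {a b a' b' : V} {α α' : Fin 4}
    (h : PrismCompatible G s((a, i), (b, i)) α s((a', i), (b', i)) α') (hab : G.Adj a b)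
    (hab' : G.Adj a' b') : Compatible a b α a' b' α' := by
  obtain ⟨h₁, h₂⟩ := h
  simp only [EdgeAdj, SimpleGraph.mem_edgeSet, SimpleGraph.boxProd_adj, Sym2.mem_iff, ne_eq,
    Sym2.eq_iff, Prod.mk.injEq, and_true, hab, hab', true_or, true_and] at h₁ h₂
  refine ⟨h₁, fun hα => ?_⟩
  by_contra! hn
  refine h₂ ⟨hn.1, ?_⟩ hα
  have hd := hn.2
  simp only [DisjointEdge] at hd
  by_cases ha : a = a' ∨ a = b'
  · exact ⟨(a, i), by grind⟩
  · exact ⟨(b, i), by grind⟩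

theorem PrismCompatible.ne_and_ne {i : Fin 2} {a b w : V} {α γ : Fin 4}
    (h : PrismCompatible G s((a, i), (b, i)) α s((w, 0), (w, 1)) γ) (hab : G.Adj a b) :
    α = γ → w ≠ a ∧ w ≠ b := by
  intro hα
  have hne : s((a, i), (b, i)) ≠ s((w, (0 : Fin 2)), (w, 1)) := by
    have := hab.ne
    simp only [ne_eq, Sym2.eq_iff, Prod.mk.injEq]
    grind
  have hi : (w, i) ∈ s((w, (0 : Fin 2)), (w, 1)) := by
    rcases Fin.exists_fin_two.1 ⟨i, rfl⟩ with rfl | rfl <;> simp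
  constructor <;> rintro rfl <;>
    exact h.2 ⟨by simp [hab], by simp, hne, _, by simp, hi⟩ hα

theorem PrismCompatible.eq_of_eq {w w' : V} {γ γ' : Fin 4}
    (h : PrismCompatible G s((w, 0), (w, 1)) γ s((w', 0), (w', 1)) γ') : w = w' → γ = γ' := by
  rintro rfl
  exact h.1 rfl

theorem TwoExtendable.exists_edgeColoring_of_le (hG : TwoExtendable G)
    {e₁ e₂ e₃ : Sym2 (V × Fin 2)} {α₁ α₂ α₃ : Fin 4} {k₁ k₂ k₃ : ℕ} (h₁ : HasKind G k₁ e₁)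
    (h₂ : HasKind G k₂ e₂) (h₃ : HasKind G k₃ e₃) (hk₁₂ : k₁ ≤ k₂) (hk₂₃ : k₂ ≤ k₃)
    (h₁₂ : PrismCompatible G e₁ α₁ e₂ α₂) (h₁₃ : PrismCompatible G e₁ α₁ e₃ α₃)
    (h₂₃ : PrismCompatible G e₂ α₂ e₃ α₃) :
    ∃ C : Sym2 (V × Fin 2) → ℕ, IsProperEdgeColoring (G.boxProd (⊤ : SimpleGraph (Fin 2))) C ∧
      ColorsBelow (G.boxProd (⊤ : SimpleGraph (Fin 2))) C 4 ∧
      C e₁ = α₁ ∧ C e₂ = α₂ ∧ C e₃ = α₃ := by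
  suffices ∃ c₀ c₁ p, IsPrismColoring G c₀ c₁ p ∧
      ∀ C : Sym2 (V × Fin 2) → ℕ, (∀ a b, C s((a, 0), (b, 0)) = c₀ a b) →
      (∀ a b, C s((a, 1), (b, 1)) = c₁ a b) → (∀ w, C s((w, 0), (w, 1)) = p w) →
      C e₁ = α₁ ∧ C e₂ = α₂ ∧ C e₃ = α₃ by
    obtain ⟨c₀, c₁, p, hc, H⟩ := this
    obtain ⟨C, hC, hlt, hC₀, hC₁, hCp⟩ := hc.exists_edgeColoring
    exact ⟨C, hC, hlt, H C hC₀ hC₁ hCp⟩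
  rcases h₁ with ⟨rfl, a₁, b₁, h₁, rfl⟩ | ⟨rfl, a₁, b₁, h₁, rfl⟩ | ⟨rfl, w₁, rfl⟩ <;>
  rcases h₂ with ⟨rfl, a₂, b₂, h₂, rfl⟩ | ⟨rfl, a₂, b₂, h₂, rfl⟩ | ⟨rfl, w₂, rfl⟩ <;>
  rcases h₃ with ⟨rfl, a₃, b₃, h₃, rfl⟩ | ⟨rfl, a₃, b₃, h₃, rfl⟩ | ⟨rfl, w₃, rfl⟩ <;>
  try omega
  · obtain ⟨c, p, hc, rfl, rfl, rfl⟩ := hG.horizontal_same_copy h₁ h₂ h₃ (h₁₂.compatible h₁ h₂)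
      (h₁₃.compatible h₁ h₃) (h₂₃.compatible h₂ h₃)
    exact ⟨c, c, p, hc, by grind⟩
  · obtain ⟨c₀, c₁, p, hc, rfl, rfl, rfl⟩ :=
      hG.horizontal_two_copies (α₃ := α₃) h₁ h₂ h₃ (h₁₂.compatible h₁ h₂)
    exact ⟨c₀, c₁, p, hc, by grind⟩
  · obtain ⟨c, p, hc, rfl, rfl, hp⟩ :=
      hG.horizontal_pair α₃ h₁ h₂ (h₁₂.compatible h₁ h₂)
    have := hp w₃ (h₁₃.ne_and_ne h₁) (h₂₃.ne_and_ne h₂)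
    exact ⟨c, c, p, hc, by grind⟩
  · obtain ⟨c₁, c₀, p, hc, rfl, rfl, rfl⟩ :=
      hG.horizontal_two_copies (α₃ := α₁) h₂ h₃ h₁ (h₂₃.compatible h₂ h₃)
    exact ⟨c₀, c₁, p, hc.swap, by grind⟩
  · obtain ⟨c₀, c₁, p, hc, rfl, rfl, rfl⟩ :=
      hG.horizontal_horizontal_vertical h₁ h₂ (h₁₃.ne_and_ne h₁) (h₂₃.ne_and_ne h₂)
    exact ⟨c₀, c₁, p, hc, by grind⟩
  · obtain ⟨c, p, hc, rfl, rfl, rfl⟩ :=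
      hG.horizontal_vertical_vertical h₁ (h₁₂.ne_and_ne h₁) (h₁₃.ne_and_ne h₁) h₂₃.eq_of_eq
    exact ⟨c, c, p, hc, by grind⟩
  · obtain ⟨c, p, hc, rfl, rfl, rfl⟩ := hG.horizontal_same_copy h₁ h₂ h₃ (h₁₂.compatible h₁ h₂)
      (h₁₃.compatible h₁ h₃) (h₂₃.compatible h₂ h₃)
    exact ⟨c, c, p, hc, by grind⟩
  · obtain ⟨c, p, hc, rfl, rfl, hp⟩ :=
      hG.horizontal_pair α₃ h₁ h₂ (h₁₂.compatible h₁ h₂)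
    have := hp w₃ (h₁₃.ne_and_ne h₁) (h₂₃.ne_and_ne h₂)
    exact ⟨c, c, p, hc, by grind⟩
  · obtain ⟨c, p, hc, rfl, rfl, rfl⟩ :=
      hG.horizontal_vertical_vertical h₁ (h₁₂.ne_and_ne h₁) (h₁₃.ne_and_ne h₁) h₂₃.eq_of_eq
    exact ⟨c, c, p, hc, by grind⟩
  · obtain ⟨c, p, hc, rfl, rfl, rfl⟩ :=
      hG.vertical h₁₂.eq_of_eq h₁₃.eq_of_eq h₂₃.eq_of_eq
    exact ⟨c, c, p, hc, by grind⟩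

theorem TwoExtendable.exists_edgeColoring (hG : TwoExtendable G)
    {e₁ e₂ e₃ : Sym2 (V × Fin 2)} {α₁ α₂ α₃ : Fin 4}
    (h₁ : e₁ ∈ (G.boxProd (⊤ : SimpleGraph (Fin 2))).edgeSet)
    (h₂ : e₂ ∈ (G.boxProd (⊤ : SimpleGraph (Fin 2))).edgeSet)
    (h₃ : e₃ ∈ (G.boxProd (⊤ : SimpleGraph (Fin 2))).edgeSet)
    (h₁₂ : PrismCompatible G e₁ α₁ e₂ α₂) (h₁₃ : PrismCompatible G e₁ α₁ e₃ α₃)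
    (h₂₃ : PrismCompatible G e₂ α₂ e₃ α₃) :
    ∃ C : Sym2 (V × Fin 2) → ℕ, IsProperEdgeColoring (G.boxProd (⊤ : SimpleGraph (Fin 2))) C ∧
      ColorsBelow (G.boxProd (⊤ : SimpleGraph (Fin 2))) C 4 ∧
      C e₁ = α₁ ∧ C e₂ = α₂ ∧ C e₃ = α₃ := by
  obtain ⟨k₁, hk₁⟩ := exists_hasKind h₁
  obtain ⟨k₂, hk₂⟩ := exists_hasKind h₂
  obtain ⟨k₃, hk₃⟩ := exists_hasKind h₃
  rcases le_total k₁ k₂ with l₁₂ | l₁₂ <;> rcases le_total k₂ k₃ with l₂₃ | l₂₃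
  · exact hG.exists_edgeColoring_of_le hk₁ hk₂ hk₃ l₁₂ l₂₃ h₁₂ h₁₃ h₂₃
  · rcases le_total k₁ k₃ with l₁₃ | l₁₃
    · obtain ⟨C, hC, hlt, e₁, e₃, e₂⟩ :=
        hG.exists_edgeColoring_of_le hk₁ hk₃ hk₂ l₁₃ l₂₃ h₁₃ h₁₂ h₂₃.symm
      exact ⟨C, hC, hlt, e₁, e₂, e₃⟩
    · obtain ⟨C, hC, hlt, e₃, e₁, e₂⟩ :=
        hG.exists_edgeColoring_of_le hk₃ hk₁ hk₂ l₁₃ l₁₂ h₁₃.symm h₂₃.symm h₁₂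
      exact ⟨C, hC, hlt, e₁, e₂, e₃⟩
  · rcases le_total k₁ k₃ with l₁₃ | l₁₃
    · obtain ⟨C, hC, hlt, e₂, e₁, e₃⟩ :=
        hG.exists_edgeColoring_of_le hk₂ hk₁ hk₃ l₁₂ l₁₃ h₁₂.symm h₂₃ h₁₃
      exact ⟨C, hC, hlt, e₁, e₂, e₃⟩
    · obtain ⟨C, hC, hlt, e₂, e₃, e₁⟩ :=
        hG.exists_edgeColoring_of_le hk₂ hk₃ hk₁ l₂₃ l₁₃ h₂₃ h₁₂.symm h₁₃.symm
      exact ⟨C, hC, hlt, e₁, e₂, e₃⟩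
  · obtain ⟨C, hC, hlt, e₃, e₂, e₁⟩ :=
      hG.exists_edgeColoring_of_le hk₃ hk₂ hk₁ l₂₃ l₁₂ h₂₃.symm h₁₃.symm h₁₂.symm
    exact ⟨C, hC, hlt, e₁, e₂, e₃⟩

end Prism

theorem Set.exists_eq_triple_of_ncard_le_three {α : Type*} {s : Set α} (hs : s.Finite)
    (hne : s.Nonempty) (h : s.ncard ≤ 3) : ∃ x y z, s = {x, y, z} := by
  have hpos := (Set.ncard_pos hs).2 hne
  obtain h1 | h2 | h3 : s.ncard = 1 ∨ s.ncard = 2 ∨ s.ncard = 3 := by omega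
  · obtain ⟨x, rfl⟩ := Set.ncard_eq_one.1 h1
    exact ⟨x, x, x, by simp⟩
  · obtain ⟨x, y, -, rfl⟩ := Set.ncard_eq_two.1 h2
    exact ⟨x, x, y, by simp⟩
  · obtain ⟨x, y, z, -, -, -, rfl⟩ := Set.ncard_eq_three.1 h3
    exact ⟨x, y, z, rfl⟩

theorem stmt19 [Fintype V] (G : SimpleGraph V) [DecidableRel G.Adj]
    (hdeg : G.maxDegree = 3) (hclass1 : chromaticIndex G = 3)
    (hext : ∀ φ : Sym2 V → Option ℕ, IsPartialProperEdgeColoring G φ →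
      UsesColors φ 3 → (Precolored φ).ncard ≤ 2 → Extendable G φ 3) :
    ∀ φ : Sym2 (V × Fin 2) → Option ℕ,
      IsPartialProperEdgeColoring (G.boxProd (⊤ : SimpleGraph (Fin 2))) φ →
      UsesColors φ 4 → (Precolored φ).ncard ≤ 3 →
      Extendable (G.boxProd (⊤ : SimpleGraph (Fin 2))) φ 4 := by
  intro φ hφ hcol hcard
  have hG := twoExtendable_of_extendable G hext
  obtain hempty | hne := (Precolored φ).eq_empty_or_nonempty
  · have : Nonempty V := by
      by_contra! hV
      simp [SimpleGraph.maxDegree] at hdeg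
    obtain ⟨v⟩ := this
    obtain ⟨c, p, hc, -⟩ := hG.vertical (w₁ := v) (w₂ := v) (w₃ := v) (γ₁ := 0)
      (fun _ => rfl) (fun _ => rfl) (fun _ => rfl)
    obtain ⟨C, hC, hlt, -⟩ := hc.exists_edgeColoring
    refine ⟨C, hC, hlt, fun e a he => ?_⟩
    have : e ∈ Precolored φ := by simp [Precolored, he]
    simp [hempty] at this
  · obtain ⟨e₁, e₂, e₃, heq⟩ :=
      Set.exists_eq_triple_of_ncard_le_three (Set.toFinite _) hne hcard
    have hcolor : ∀ e ∈ Precolored φ, ∃ α : Fin 4, φ e = some α.val := by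
      intro e he
      obtain ⟨a, ha⟩ := Option.ne_none_iff_exists'.1 he
      exact ⟨⟨a, hcol e a ha⟩, ha⟩
    have m₁ : e₁ ∈ Precolored φ := by simp [heq]
    have m₂ : e₂ ∈ Precolored φ := by simp [heq]
    have m₃ : e₃ ∈ Precolored φ := by simp [heq]
    obtain ⟨α₁, h₁⟩ := hcolor e₁ m₁
    obtain ⟨α₂, h₂⟩ := hcolor e₂ m₂
    obtain ⟨α₃, h₃⟩ := hcolor e₃ m₃
    have hcomp : ∀ (e e' : Sym2 (V × Fin 2)) (α α' : Fin 4), φ e = some α.val →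
        φ e' = some α'.val → PrismCompatible G e α e' α' := by
      intro e e' α α' he he'
      refine ⟨?_, fun hadj hα => hφ.2 hadj (by simp [he]) (by rw [he, he', hα])⟩
      rintro rfl
      rw [he, Option.some_inj] at he'
      exact Fin.ext he'
    obtain ⟨C, hC, hlt, c₁, c₂, c₃⟩ := hG.exists_edgeColoring (hφ.1 _ m₁) (hφ.1 _ m₂)
      (hφ.1 _ m₃) (hcomp _ _ _ _ h₁ h₂) (hcomp _ _ _ _ h₁ h₃) (hcomp _ _ _ _ h₂ h₃)
    refine ⟨C, hC, hlt, fun e a he => ?_⟩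
    have hmem : e ∈ Precolored φ := by simp [Precolored, he]
    rw [heq] at hmem
    rcases hmem with rfl | rfl | rfl <;> simp_all
end
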